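/- For every positive integer p, the following identity holds in ℚ[[x_1,…,x_m,y_1,…,y_n]] (it is the character formula for the osp(2m+1|2n) representation V(p), stripped of the lowest-weight prefactor): ∏_{i=1}^m ∏_{j=1}^n (1+x_i y_j) · Σ_{σ∈H_p} (−1)^{(|σ|−r(σ)(p−1))/2} s_σ(x|y) = ∏_{i=1}^m (1−x_i) · ∏_{1≤i<k≤m} (1−x_i x_k) · ∏_{j=1}^n (1−y_j) · ∏_{1≤j<l≤n} (1−y_j y_l) · Σ_{λ∈H, λ_1≤p} s_λ(x|y). -/

import Mathlib

noncomputable section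

/-- A skew semistandard Young tableau of shape `lam/tau` with entries in
`{0,…,m-1}` (representing the variables `x_1,…,x_m`): entries are `< m` on the
cells of `lam \ tau`, rows are weakly increasing, columns are strictly
increasing, and the tableau vanishes outside the skew shape. -/
def IsSkewSSYT (m : ℕ) (lam tau : YoungDiagram) (T : ℕ → ℕ → ℕ) : Prop :=
  (∀ i j : ℕ, (i, j) ∈ lam.cells \ tau.cells → T i j < m) ∧
  (∀ i j1 j2 : ℕ, j1 ≤ j2 → (i, j1) ∈ lam.cells \ tau.cells →
      (i, j2) ∈ lam.cells \ tau.cells → T i j1 ≤ T i j2) ∧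
  (∀ i1 i2 j : ℕ, i1 < i2 → (i1, j) ∈ lam.cells \ tau.cells →
      (i2, j) ∈ lam.cells \ tau.cells → T i1 j < T i2 j) ∧
  (∀ i j : ℕ, (i, j) ∉ lam.cells \ tau.cells → T i j = 0)

/-- The coefficient of the monomial `d` in the supersymmetric Schur function
`s_lam(x|y) = Σ_{τ ⊆ lam} s_{lam/τ}(x) s_{τ'}(y)`: the number of triples
`(τ, T_x, T_y)` where `τ ⊆ lam`, `T_x` is a skew SSYT of shape `lam/τ` in the
`x`-alphabet with content `d ∘ inl`, and `T_y` is an SSYT of shape `τ'` in the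
`y`-alphabet with content `d ∘ inr`. -/
def superSchurCoeff (m n : ℕ) (lam : YoungDiagram) (d : (Fin m ⊕ Fin n) →₀ ℕ) : ℕ :=
  Set.ncard {t : YoungDiagram × (ℕ → ℕ → ℕ) × (ℕ → ℕ → ℕ) |
    t.1 ≤ lam ∧ IsSkewSSYT m lam t.1 t.2.1 ∧
    IsSkewSSYT n t.1.transpose ⊥ t.2.2 ∧
    (∀ k : Fin m, d (Sum.inl k)
        = ((lam.cells \ t.1.cells).filter fun c => t.2.1 c.1 c.2 = k.val).card) ∧
    (∀ k : Fin n, d (Sum.inr k)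
        = ((t.1.transpose.cells \ (⊥ : YoungDiagram).cells).filter
            fun c => t.2.2 c.1 c.2 = k.val).card)}

/-- The supersymmetric Schur function `s_lam(x|y)` as a formal power series in
`x_1,…,x_m, y_1,…,y_n`. -/
def superSchur (m n : ℕ) (lam : YoungDiagram) : MvPowerSeries (Fin m ⊕ Fin n) ℚ :=
  fun d => (superSchurCoeff m n lam d : ℚ)

/-- The coefficientwise sum `Σ_{lam ∈ S} c(lam) · s_lam(x|y)` of supersymmetric
Schur functions over a set `S` of partitions with coefficients `c`; it is well
defined coefficientwise since only finitely many partitions contribute to a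
given coefficient. -/
def superSchurSum (m n : ℕ) (S : Set YoungDiagram) (c : YoungDiagram → ℚ) :
    MvPowerSeries (Fin m ⊕ Fin n) ℚ :=
  fun d => ∑' lam : S, c lam * (superSchurCoeff m n (lam : YoungDiagram) d : ℚ)


open MvPowerSeries

/-- The Frobenius rank of a partition: the number of diagonal cells. -/
def frobRank (lam : YoungDiagram) : ℕ :=
  (lam.cells.filter fun c => c.1 = c.2).card

/-- The set `P_p` of partitions whose Frobenius arm and leg lengths satisfy
`a_k = b_k + p` for `k = 1,…,r(σ)`; equivalently `σ_k = σ'_k + p` for all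
`k ≤ r(σ)` (0-based: `rowLen σ k = colLen σ k + p` for all `k < r(σ)`). -/
def frobSet (p : ℕ) : Set YoungDiagram :=
  {lam | ∀ k < frobRank lam, lam.rowLen k = lam.colLen k + p}


namespace CF
open Finset

/-- `∏ (1-x_i) ∏_{i<j} (1 - x_i x_j)` -/
def DD {R : Type*} [CommRing R] {M : ℕ} (x : Fin M → R) : R :=
  (∏ i, (1 - x i)) * ∏ i, ∏ j, if i < j then 1 - x i * x j else 1

theorem DD_succAbove {R : Type*} [CommRing R] {M : ℕ} (x : Fin (M+1) → R) (i : Fin (M+1)) :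
    DD x = ((1 - x i) * ∏ k, (1 - x i * x (i.succAbove k))) * DD (fun k => x (i.succAbove k)) := by
  unfold DD
  rw [Fin.prod_univ_succAbove _ i, Fin.prod_univ_succAbove _ i, Fin.prod_univ_succAbove _ i]
  have h1 : ∀ k, (∏ j, if i.succAbove k < j then 1 - x (i.succAbove k) * x j else 1)
      = (if i.succAbove k < i then 1 - x (i.succAbove k) * x i else 1) *
        ∏ j, if k < j then 1 - x (i.succAbove k) * x (i.succAbove j) else 1 := by
    intro k
    rw [Fin.prod_univ_succAbove _ i]
    simp only [Fin.succAbove_lt_succAbove_iff]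
  simp only [h1, Finset.prod_mul_distrib, lt_irrefl, if_false, one_mul]
  have h2 : (∏ k, (1 - x i * x (i.succAbove k)))
     = (∏ k, if i < i.succAbove k then 1 - x i * x (i.succAbove k) else 1) *
      ∏ k, (if i.succAbove k < i then 1 - x (i.succAbove k) * x i else 1) := by
    rw [← Finset.prod_mul_distrib]
    refine Finset.prod_congr rfl fun k _ => ?_
    rcases lt_trichotomy i (i.succAbove k) with h | h | h
    · simp [h, h.not_gt]
    · exact absurd h.symm (Fin.succAbove_ne i k)
    · simp [h, h.not_gt, mul_comm]
  rw [h2]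
  ring

def altA {R : Type*} [CommRing R] {M : ℕ} (c : ℕ) (x : Fin M → R) : R :=
  ∑ l ∈ (univ : Finset (Fin M → Fin c)).filter StrictMono,
    Matrix.det (Matrix.of fun i j => x i ^ (l j : ℕ))

def altB {R : Type*} [CommRing R] {M : ℕ} (c : ℕ) (x : Fin M → R) : R :=
  Matrix.det (Matrix.of fun i j : Fin M => x i ^ (j : ℕ) - x i ^ (c + (Fin.rev j : ℕ)))

theorem altA_rec {R : Type*} [CommRing R] {M : ℕ} (c : ℕ) (x : Fin (M+1) → R) :
    altA (c+1) x = (∏ i, x i) * altA c x +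
      ∑ i : Fin (M+1), (-1)^(i:ℕ) * ((∏ k, x (i.succAbove k)) *
        altA c (fun k => x (i.succAbove k))) := by
  unfold altA
  rw [← Finset.sum_filter_add_sum_filter_not _ (fun l : Fin (M+1) → Fin (c+1) => l 0 ≠ 0)]
  congr 1
  · rw [Finset.mul_sum]
    symm
    refine Finset.sum_bij (fun l _ => fun j => (l j).succ) ?_ ?_ ?_ ?_
    · intro l hl
      simp only [mem_filter, mem_univ, true_and] at hl ⊢
      refine ⟨fun a b hab => by simpa using hl hab, Fin.succ_ne_zero _⟩
    · intro l _ l' _ h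
      funext j
      exact Fin.succ_injective _ (congrFun h j)
    · intro l hl
      simp only [mem_filter, mem_univ, true_and] at hl
      have hne : ∀ j, l j ≠ 0 := fun j hj => hl.2 (by
        have := hl.1.monotone (Fin.zero_le j)
        rw [hj] at this
        exact le_antisymm this (Fin.zero_le _))
      refine ⟨fun j => (l j).pred (hne j), ?_, ?_⟩
      · simp only [mem_filter, mem_univ, true_and]
        intro a b hab
        simpa using hl.1 hab
      · funext j; simp
    · intro l hl
      rw [← Matrix.det_mul_column]
      congr 1
      ext i j
      simp [pow_succ, mul_comm]
  · have h0 : ∀ i : Fin (M+1), (-1 : R)^(i:ℕ) * ((∏ k, x (i.succAbove k)) *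
        ∑ l ∈ (univ : Finset (Fin M → Fin c)).filter StrictMono,
          Matrix.det (Matrix.of fun i_1 j => x (i.succAbove i_1) ^ (l j : ℕ)))
        = ∑ l ∈ (univ : Finset (Fin M → Fin c)).filter StrictMono,
          (-1 : R)^(i:ℕ) * Matrix.det (Matrix.of fun i_1 j => x (i.succAbove i_1) ^ ((l j : ℕ) + 1)) := by
      intro i
      rw [Finset.mul_sum, Finset.mul_sum]
      refine Finset.sum_congr rfl fun l _ => ?_
      congr 1
      rw [← Matrix.det_mul_column]
      congr 1
      ext i j
      simp [pow_succ, mul_comm]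
    simp_rw [h0]
    rw [Finset.sum_comm]
    symm
    refine Finset.sum_bij (fun l _ => Fin.cons 0 (fun j => (l j).succ)) ?_ ?_ ?_ ?_
    · intro l hl
      simp only [mem_filter, mem_univ, true_and] at hl ⊢
      refine ⟨?_, by simp⟩
      intro a b hab
      induction b using Fin.cases with
      | zero => exact absurd hab (Fin.not_lt_zero a)
      | succ b =>
        induction a using Fin.cases with
        | zero => simp
        | succ a => simpa using hl (by simpa using hab)
    · intro l _ l' _ h
      funext j
      exact Fin.succ_injective _ (by simpa using congrFun h j.succ)
    · intro l hl
      simp only [mem_filter, mem_univ, true_and, not_not] at hl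
      have hne : ∀ j : Fin M, l j.succ ≠ 0 := fun j hj => by
        have := hl.1 (Fin.succ_pos j)
        rw [hj] at this
        exact absurd this (Fin.not_lt_zero _)
      refine ⟨fun j => (l j.succ).pred (hne j), ?_, ?_⟩
      · simp only [mem_filter, mem_univ, true_and]
        intro a b hab
        simpa using hl.1 (Fin.succ_lt_succ_iff.2 hab)
      · funext j
        induction j using Fin.cases with
        | zero => simp [hl.2]
        | succ j => simp
    · intro l hl
      rw [Matrix.det_succ_column_zero]
      refine Finset.sum_congr rfl fun i _ => ?_
      simp only [Matrix.of_apply, Fin.cons_zero, Fin.val_zero, pow_zero, mul_one]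
      congr 2

theorem altB_zero {R : Type*} [CommRing R] {M : ℕ} (x : Fin (M+1) → R) : altB 0 x = 0 := by
  unfold altB
  rcases Nat.eq_zero_or_pos M with h | h
  · subst h
    simp
  · have hne : (0 : Fin (M+1)) ≠ Fin.last M := by
      intro h'; have := congrArg Fin.val h'; simp at this; omega
    rw [← Matrix.det_updateCol_add_self _ hne]
    apply Matrix.det_eq_zero_of_column_eq_zero 0
    intro i
    simp

/-- interpolation polynomial -/
theorem interp {K : Type*} [Field K] {M : ℕ} (x : Fin (M+1) → K) (hx : ∀ i, x i ≠ 0)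
    (hx1 : ∀ i, 1 + x i ≠ 0) (J : Finset (Fin (M+1))) :
    ∃ q : Fin (M+1) → K, q 0 = 1 - ∏ i ∈ J, x i ∧
      (∀ i ∈ J, ∑ j : Fin (M+1), x i ^ (j:ℕ) * q j = (1 - x i) * ∏ k, (1 - x i * x (i.succAbove k))) ∧
      (∀ i ∉ J, ∑ j, x i ^ (Fin.rev j : ℕ) * q j = 0) := by
  classical
  let n : Polynomial K := ∏ k ∈ J, (1 - Polynomial.C (x k) * Polynomial.X)
    - ∏ k ∈ J, (Polynomial.C (x k) - Polynomial.X)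
  have hroot : n.IsRoot (-1) := by
    simp only [n, Polynomial.IsRoot, Polynomial.eval_sub, Polynomial.eval_prod, Polynomial.eval_mul,
      Polynomial.eval_C, Polynomial.eval_X, Polynomial.eval_one]
    rw [sub_eq_zero]
    exact Finset.prod_congr rfl fun k _ => by ring
  obtain ⟨Q0, hQ0⟩ := Polynomial.dvd_iff_isRoot.2 hroot
  let E : Polynomial K := ∏ k ∈ Jᶜ, (1 - Polynomial.C (x k) * Polynomial.X)
  let Q := Q0 * E
  have hQ : (Polynomial.X - Polynomial.C (-1)) * Q = n * E := by
    rw [hQ0]; ring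
  have hdegn : n.natDegree ≤ J.card := by
    refine (Polynomial.natDegree_sub_le _ _).trans (max_le ?_ ?_)
    · refine (Polynomial.natDegree_prod_le _ _).trans ?_
      rw [Finset.card_eq_sum_ones]
      refine Finset.sum_le_sum fun k _ => ?_
      compute_degree
    · refine (Polynomial.natDegree_prod_le _ _).trans ?_
      rw [Finset.card_eq_sum_ones]
      refine Finset.sum_le_sum fun k _ => ?_
      compute_degree
  have hdegE : E.natDegree ≤ Jᶜ.card := by
    refine (Polynomial.natDegree_prod_le _ _).trans ?_
    rw [Finset.card_eq_sum_ones]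
    refine Finset.sum_le_sum fun k _ => ?_
    compute_degree
  have hdeg : Q.natDegree < M + 1 := by
    by_cases hQz : Q = 0
    · simp [hQz]
    have h1 := (Polynomial.monic_X_sub_C (-1 : K)).natDegree_mul' hQz
    rw [hQ, Polynomial.natDegree_X_sub_C] at h1
    have h2 : (n * E).natDegree ≤ J.card + Jᶜ.card :=
      Polynomial.natDegree_mul_le.trans (Nat.add_le_add hdegn hdegE)
    rw [Finset.card_add_card_compl, Fintype.card_fin] at h2
    omega
  have heval : ∀ z, Q.eval z = ∑ j : Fin (M+1), Q.coeff j * z ^ (j:ℕ) := by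
    intro z
    rw [Polynomial.eval_eq_sum_range' hdeg, Finset.sum_range]
  have hQe : ∀ z, (z + 1) * Q.eval z = n.eval z * E.eval z := by
    intro z
    have := congrArg (Polynomial.eval z) hQ
    simpa using this
  refine ⟨fun j => Q.coeff j, ?_, ?_, ?_⟩
  · have := hQe 0
    simp only [n, E, Polynomial.eval_sub, Polynomial.eval_prod, Polynomial.eval_mul,
      Polynomial.eval_C, Polynomial.eval_X, Polynomial.eval_one, mul_zero, sub_zero,
      Finset.prod_const_one, mul_one, zero_add, one_mul] at this
    rw [← this, ← Polynomial.coeff_zero_eq_eval_zero]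
    rfl
  · intro i hi
    have h1 := hQe (x i)
    have h2 : n.eval (x i) * E.eval (x i) = ∏ k, (1 - x k * x i) := by
      simp only [n, E, Polynomial.eval_sub, Polynomial.eval_prod, Polynomial.eval_mul,
        Polynomial.eval_C, Polynomial.eval_X, Polynomial.eval_one]
      have hz : ∏ k ∈ J, (x k - x i) = 0 := Finset.prod_eq_zero (i := i) hi (sub_self _)
      rw [hz, sub_zero,
        Finset.prod_mul_prod_compl]
    rw [h2, Fin.prod_univ_succAbove _ i] at h1
    have h3 : x i + 1 ≠ 0 := by rw [add_comm]; exact hx1 i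
    apply mul_left_cancel₀ h3
    rw [show ∑ j : Fin (M+1), x i ^ (j:ℕ) * Q.coeff j = Q.eval (x i) by
      rw [heval]; exact Finset.sum_congr rfl fun j _ => mul_comm _ _]
    rw [h1]
    have : ∏ k, (1 - x (i.succAbove k) * x i) = ∏ k, (1 - x i * x (i.succAbove k)) :=
      Finset.prod_congr rfl fun k _ => by ring
    rw [this]; ring
  · intro i hi
    have h0 : Q.eval (x i)⁻¹ = 0 := by
      have : E.eval (x i)⁻¹ = 0 := by
        simp only [E, Polynomial.eval_sub, Polynomial.eval_prod, Polynomial.eval_mul,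
          Polynomial.eval_C, Polynomial.eval_X, Polynomial.eval_one]
        exact Finset.prod_eq_zero (i := i) (by simpa using hi) (by simp [hx i])
      simp [Q, this]
    have : ∑ j : Fin (M+1), x i ^ (Fin.rev j : ℕ) * Q.coeff j = x i ^ M * Q.eval (x i)⁻¹ := by
      rw [heval, Finset.mul_sum]
      refine Finset.sum_congr rfl fun j _ => ?_
      have hj : (Fin.rev j : ℕ) = M - j := by rw [Fin.val_rev]; omega
      rw [hj, inv_pow, pow_sub₀ _ (hx i) (by omega)]
      ring
    rw [this, h0, mul_zero]

def pw {R : Type*} {M : ℕ} (J : Finset (Fin M)) (a b : Matrix (Fin M) (Fin M) R) :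
    Matrix (Fin M) (Fin M) R := Matrix.of fun i j => if i ∈ J then a i j else b i j

theorem det_add_rows {R : Type*} [CommRing R] {M : ℕ} (a b : Matrix (Fin M) (Fin M) R) :
    (a + b).det = ∑ J : Finset (Fin M), (pw J a b).det := by
  have := (Matrix.detRowAlternating (R := R) (n := Fin M)).map_add_univ a b
  refine this.trans (Finset.sum_congr rfl fun J _ => ?_)
  refine congrArg Matrix.det ?_
  funext i j
  change (if i ∈ J then a i else b i) j = if i ∈ J then a i j else b i j
  split_ifs <;> rfl

theorem altB_rec {K : Type*} [Field K] {M : ℕ} (c : ℕ) (x : Fin (M+1) → K) (hx : ∀ i, x i ≠ 0)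
    (hx1 : ∀ i, 1 + x i ≠ 0) :
    altB (c+1) x = (∏ i, x i) * altB c x +
      ∑ i : Fin (M+1), (-1)^(i:ℕ) * ((∏ k, x (i.succAbove k)) *
        (((1 - x i) * ∏ k, (1 - x i * x (i.succAbove k))) *
        altB c (fun k => x (i.succAbove k)))) := by
  classical
  let a : Matrix (Fin (M+1)) (Fin (M+1)) K := Matrix.of fun i j => x i ^ (j:ℕ)
  let b : Matrix (Fin (M+1)) (Fin (M+1)) K := Matrix.of fun i j => - x i ^ (c + 1 + (Fin.rev j : ℕ))
  let cc : Fin (M+1) → K := fun i => (1 - x i) * ∏ k, (1 - x i * x (i.succAbove k))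
  have h1 : altB (c+1) x = (a + b).det := by
    unfold altB; congr 1; ext i j; simp [a, b, sub_eq_add_neg]
  have h2 : (∏ i, x i) * altB c x =
      ((Matrix.of fun i j => x i * a i j : Matrix (Fin (M+1)) (Fin (M+1)) K) + b).det := by
    unfold altB
    rw [← Matrix.det_mul_column]; congr 1; ext i j; simp [a, b]; ring
  have h3 : ∑ i : Fin (M+1), (-1)^(i:ℕ) * ((∏ k, x (i.succAbove k)) *
        (((1 - x i) * ∏ k, (1 - x i * x (i.succAbove k))) *
        altB c (fun k => x (i.succAbove k)))) = ((a + b).updateCol 0 cc).det := by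
    rw [Matrix.det_succ_column_zero]
    refine Finset.sum_congr rfl fun i _ => ?_
    have : (∏ k, x (i.succAbove k)) * altB c (fun k => x (i.succAbove k)) =
        (((a + b).updateCol 0 cc).submatrix i.succAbove Fin.succ).det := by
      unfold altB
      rw [← Matrix.det_mul_column]; congr 1; ext k j
      have : (Fin.rev j.succ : ℕ) = Fin.rev j := by simp
      simp [a, b, this]; ring
    rw [← this]
    simp only [Matrix.updateCol_self, cc]
    ring
  have h4 : (a + b).updateCol 0 cc = a.updateCol 0 cc + b.updateCol 0 0 := by
    ext i j
    by_cases hj : j = 0 <;> simp [hj, Matrix.updateCol_apply]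
  rw [h1, h2, h3, h4, det_add_rows, det_add_rows, det_add_rows, ← Finset.sum_add_distrib]
  refine Finset.sum_congr rfl fun J _ => ?_
  obtain ⟨q, hq0, hq1, hq2⟩ := interp x hx hx1 J
  set P : Matrix (Fin (M+1)) (Fin (M+1)) K := pw J a b with hP
  have e1 : (pw J (Matrix.of fun i j => x i * a i j : Matrix (Fin (M+1)) (Fin (M+1)) K) b).det = (∏ i ∈ J, x i) * P.det := by
    have : (∏ i ∈ J, x i) = ∏ i, (if i ∈ J then x i else 1) := by
      rw [Finset.prod_ite_mem]; simp
    rw [this, ← Matrix.det_mul_column]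
    congr 1
    ext i j
    by_cases hi : i ∈ J <;> simp [P, pw, hi]
  have e2 : pw J (a.updateCol 0 cc) (b.updateCol 0 0) = P.updateCol 0 (P.mulVec q) := by
    ext i j
    by_cases hj : j = 0
    · subst hj
      by_cases hi : i ∈ J
      · have := hq1 i hi
        simp [P, pw, hi, Matrix.mulVec, dotProduct, a, cc, this]
      · have := hq2 i hi
        simp only [hi, P, pw, if_false, Matrix.updateCol_self,
          Matrix.mulVec, dotProduct, b, Matrix.of_apply, Pi.zero_apply]
        have e : ∑ j, -x i ^ (c + 1 + (Fin.rev j : ℕ)) * q j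
            = - x i ^ (c+1) * ∑ j, x i ^ (Fin.rev j : ℕ) * q j := by
          rw [Finset.mul_sum]
          exact Finset.sum_congr rfl fun j _ => by ring
        rw [e, this, mul_zero]
    · by_cases hi : i ∈ J <;> simp [P, pw, hi, hj]
  have e3 : (P.updateCol 0 (P.mulVec q)).det = P.det * q 0 := by
    rw [← Matrix.cramer_apply, Matrix.cramer_eq_adjugate_mulVec, Matrix.mulVec_mulVec,
      Matrix.adjugate_mul, Matrix.smul_mulVec, Matrix.one_mulVec]
    simp
  rw [e1, e2, e3, hq0]
  ring

theorem core_field {K : Type*} [Field K] (c : ℕ) : ∀ {M : ℕ} (x : Fin M → K)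
    (_ : ∀ i, x i ≠ 0) (_ : ∀ i, 1 + x i ≠ 0), DD x * altA c x = altB c x := by
  induction c with
  | zero =>
    intro M x hx hx1
    cases M with
    | zero => simp [DD, altA, altB, Subsingleton.strictMono, Finset.filter_true_of_mem]
    | succ M => simp [altB_zero, altA]
  | succ c ih =>
    intro M x hx hx1
    cases M with
    | zero => simp [DD, altA, altB, Subsingleton.strictMono, Finset.filter_true_of_mem]
    | succ M =>
      rw [altA_rec, altB_rec c x hx hx1, ← ih x hx hx1, mul_add, Finset.mul_sum]
      congr 1
      · ring
      · refine Finset.sum_congr rfl fun i _ => ?_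
        rw [← ih (fun k => x (i.succAbove k)) (fun k => hx _) (fun k => hx1 _), DD_succAbove x i]
        ring

end CF


namespace CF
open Finset

/-- Jacobi-Trudi determinant attached to the power series `h` and exponents `l`. -/
noncomputable def jt {R : Type*} [CommRing R] {M : ℕ} (h : PowerSeries R) (l : Fin M → ℕ) : R :=
  Matrix.det (Matrix.of fun a r : Fin M => PowerSeries.coeff (l a) (PowerSeries.X ^ (r:ℕ) * h))

noncomputable def FF {R : Type*} [CommRing R] (c M : ℕ) (h : PowerSeries R) : R :=
  ∑ l ∈ (univ : Finset (Fin M → Fin c)).filter StrictMono, jt h (fun a => (l a : ℕ))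

noncomputable def GG {R : Type*} [CommRing R] (c M : ℕ) (h : PowerSeries R) : R :=
  Matrix.det (Matrix.of fun a r : Fin M => PowerSeries.coeff (a:ℕ) (PowerSeries.X ^ (r:ℕ) * h)
    - PowerSeries.coeff (c + (Fin.rev a : ℕ)) (PowerSeries.X ^ (r:ℕ) * h))

theorem map_DD {R S : Type*} [CommRing R] [CommRing S] (φ : R →+* S) {M : ℕ} (x : Fin M → R) :
    φ (DD x) = DD (fun i => φ (x i)) := by
  unfold DD
  simp only [map_mul, map_prod, map_sub, map_one]
  congr 1
  refine Finset.prod_congr rfl fun i _ => Finset.prod_congr rfl fun j _ => ?_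
  split_ifs <;> simp

theorem map_coeffX {R S : Type*} [CommRing R] [CommRing S] (φ : R →+* S) (h : PowerSeries R)
    (l r : ℕ) : φ (PowerSeries.coeff l (PowerSeries.X ^ r * h)) =
      PowerSeries.coeff l (PowerSeries.X ^ r * PowerSeries.map φ h) := by
  rw [PowerSeries.coeff_X_pow_mul', PowerSeries.coeff_X_pow_mul']
  split_ifs <;> simp

theorem map_jt {R S : Type*} [CommRing R] [CommRing S] (φ : R →+* S) {M : ℕ} (h : PowerSeries R)
    (l : Fin M → ℕ) : φ (jt h l) = jt (PowerSeries.map φ h) l := by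
  unfold jt
  rw [RingHom.map_det]
  congr 1
  ext a r
  simp [map_coeffX]

theorem map_FF {R S : Type*} [CommRing R] [CommRing S] (φ : R →+* S) (c M : ℕ)
    (h : PowerSeries R) : φ (FF c M h) = FF c M (PowerSeries.map φ h) := by
  unfold FF
  simp only [map_sum, map_jt]

theorem map_GG {R S : Type*} [CommRing R] [CommRing S] (φ : R →+* S) (c M : ℕ)
    (h : PowerSeries R) : φ (GG c M h) = GG c M (PowerSeries.map φ h) := by
  unfold GG
  rw [RingHom.map_det]
  congr 1
  ext a r
  simp [map_coeffX]

theorem geom_inv {R : Type*} [CommRing R] (a : R) :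
    (PowerSeries.mk fun n => a ^ n) * (1 - PowerSeries.C a * PowerSeries.X) = 1 := by
  ext n
  rw [mul_sub, mul_one, ← mul_assoc, mul_comm _ (PowerSeries.C a), mul_assoc]
  cases n with
  | zero => simp
  | succ n =>
    rw [map_sub, PowerSeries.coeff_C_mul, PowerSeries.coeff_succ_mul_X]
    simp [PowerSeries.coeff_one, pow_succ, mul_comm]

theorem exists_Q {K : Type*} [Field K] {M : ℕ} (x : Fin M → K) (h : PowerSeries K)
    (hh : h * ∏ k, (1 - PowerSeries.C (x k) * PowerSeries.X) = 1) :
    ∃ Q : Matrix (Fin M) (Fin M) K, ∀ l i, x i ^ l =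
      ∑ r : Fin M, PowerSeries.coeff l (PowerSeries.X ^ (r:ℕ) * h) * Q r i := by
  classical
  let P : Fin M → Polynomial K := fun i =>
    ∏ k ∈ univ.erase i, (1 - Polynomial.C (x k) * Polynomial.X)
  have hdeg : ∀ i, (P i).natDegree < M := by
    intro i
    have : (P i).natDegree ≤ (univ.erase i).card := by
      refine (Polynomial.natDegree_prod_le _ _).trans ?_
      rw [Finset.card_eq_sum_ones]
      refine Finset.sum_le_sum fun k _ => ?_
      compute_degree
    rw [Finset.card_erase_of_mem (mem_univ i), Finset.card_univ, Fintype.card_fin] at this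
    have := i.2
    omega
  have hP : ∀ i, (P i : PowerSeries K) =
      ∏ k ∈ univ.erase i, (1 - PowerSeries.C (x k) * PowerSeries.X) := by
    intro i
    have : (P i : PowerSeries K) = Polynomial.coeToPowerSeries.ringHom (P i) := rfl
    rw [this, map_prod]
    refine Finset.prod_congr rfl fun k _ => ?_
    simp
  have hinv : ∀ i, h * (P i : PowerSeries K) = PowerSeries.mk fun n => x i ^ n := by
    intro i
    have h1 : h * (P i : PowerSeries K) * (1 - PowerSeries.C (x i) * PowerSeries.X) = 1 := by
      rw [hP, mul_assoc, Finset.prod_erase_mul _ _ (mem_univ i), hh]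
    have h2 := geom_inv (x i)
    calc h * (P i : PowerSeries K) = h * (P i : PowerSeries K) *
          ((PowerSeries.mk fun n => x i ^ n) * (1 - PowerSeries.C (x i) * PowerSeries.X)) := by
            rw [h2, mul_one]
      _ = (h * (P i : PowerSeries K) * (1 - PowerSeries.C (x i) * PowerSeries.X)) *
          (PowerSeries.mk fun n => x i ^ n) := by ring
      _ = _ := by rw [h1, one_mul]
  refine ⟨Matrix.of fun r i => (P i).coeff r, fun l i => ?_⟩
  have h1 : (P i : PowerSeries K) = ∑ r : Fin M, PowerSeries.C ((P i).coeff r) * PowerSeries.X ^ (r:ℕ) := by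
    conv_lhs => rw [Polynomial.as_sum_range_C_mul_X_pow' (P i) (hdeg i), Finset.sum_range]
    have : ∀ q : Polynomial K, (q : PowerSeries K) = Polynomial.coeToPowerSeries.ringHom q := fun _ => rfl
    rw [this, map_sum]
    refine Finset.sum_congr rfl fun r _ => ?_
    simp
  have h2 := congrArg (PowerSeries.coeff l) (hinv i)
  rw [PowerSeries.coeff_mk] at h2
  rw [← h2, h1, Finset.mul_sum, map_sum]
  refine Finset.sum_congr rfl fun r _ => ?_
  rw [Matrix.of_apply, mul_comm h, mul_assoc, PowerSeries.coeff_C_mul, mul_comm]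

theorem jt_id {R : Type*} [CommRing R] {M : ℕ} (h : PowerSeries R)
    (h0 : PowerSeries.constantCoeff h = 1) : jt h (fun a : Fin M => (a : ℕ)) = 1 := by
  unfold jt
  rw [Matrix.det_of_isLowerTriangular]
  · simp [PowerSeries.coeff_X_pow_mul', h0]
  · intro a r har
    have : a < r := har
    simp [PowerSeries.coeff_X_pow_mul', this]

theorem FG_field {K : Type*} [Field K] (c M : ℕ) (x : Fin M → K)
    (hx : ∀ i, x i ≠ 0) (hx1 : ∀ i, 1 + x i ≠ 0) (hinj : Function.Injective x) (h : PowerSeries K)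
    (hh : h * ∏ k, (1 - PowerSeries.C (x k) * PowerSeries.X) = 1) :
    DD x * FF c M h = GG c M h := by
  obtain ⟨Q, hQ⟩ := exists_Q x h hh
  have h0 : PowerSeries.constantCoeff h = 1 := by
    have := congrArg PowerSeries.constantCoeff hh
    simpa [map_prod] using this
  have hjt : ∀ l : Fin M → ℕ, Matrix.det (Matrix.of fun i j => x i ^ (l j)) = jt h l * Q.det := by
    intro l
    rw [← Matrix.det_transpose]
    unfold jt
    rw [← Matrix.det_mul]
    congr 1
    ext a i
    simp [Matrix.mul_apply, hQ (l a) i]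
  have hG : altB c x = GG c M h * Q.det := by
    unfold altB GG
    rw [← Matrix.det_transpose, ← Matrix.det_mul]
    congr 1
    ext a i
    simp only [Matrix.transpose_apply, Matrix.of_apply, Matrix.mul_apply, sub_mul,
      Finset.sum_sub_distrib]
    rw [hQ a i, hQ (c + (Fin.rev a : ℕ)) i]
  have hF : altA c x = FF c M h * Q.det := by
    unfold altA FF
    rw [Finset.sum_mul]
    exact Finset.sum_congr rfl fun l _ => hjt _
  have hdet : Q.det ≠ 0 := by
    have := hjt (fun a => (a:ℕ))
    rw [jt_id h h0, one_mul] at this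
    rw [← this]
    exact Matrix.det_vandermonde_ne_zero_iff.2 hinj
  have := core_field c x hx hx1
  rw [hF, hG, ← mul_assoc] at this
  exact mul_right_cancel₀ hdet this

theorem FG {R : Type*} [CommRing R] (c M : ℕ) (x : Fin M → R) (h : PowerSeries R)
    (hh : h * ∏ k, (1 - PowerSeries.C (x k) * PowerSeries.X) = 1) :
    DD x * FF c M h = GG c M h := by
  let Z := MvPolynomial (Fin M) ℤ
  let L := FractionRing Z
  let PZ : PowerSeries Z := ∏ k, (1 - PowerSeries.C (MvPolynomial.X k : Z) * PowerSeries.X)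
  let hZ : PowerSeries Z := PowerSeries.invOfUnit PZ 1
  have hhZ : hZ * PZ = 1 := by
    rw [mul_comm]
    exact PowerSeries.mul_invOfUnit _ _ (by simp [PZ, map_prod])
  let ι : Z →+* L := algebraMap Z L
  have hι : Function.Injective ι := IsFractionRing.injective Z L
  have key : DD (fun k => (MvPolynomial.X k : Z)) * FF c M hZ = GG c M hZ := by
    apply hι
    rw [map_mul, map_DD, map_FF, map_GG]
    apply FG_field
    · intro i
      rw [Ne, map_eq_zero_iff ι hι]
      exact MvPolynomial.X_ne_zero i
    · intro i
      rw [← map_one ι, ← map_add, Ne, map_eq_zero_iff ι hι]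
      intro h0
      have := congrArg (MvPolynomial.eval (fun _ => (0:ℤ))) h0
      simp at this
    · intro i j hij
      exact MvPolynomial.X_injective (hι hij)
    · have h1 := congrArg (PowerSeries.map ι) hhZ
      rw [map_mul, map_one] at h1
      rw [show PowerSeries.map ι PZ = ∏ k, (1 - PowerSeries.C (ι (MvPolynomial.X k)) * PowerSeries.X)
        by simp [PZ, map_prod]] at h1
      exact h1
  let φ : Z →+* R := (MvPolynomial.aeval x).toRingHom
  have hφ : ∀ k, φ (MvPolynomial.X k) = x k := fun k => MvPolynomial.aeval_X x k
  have hP2 : PowerSeries.map φ PZ = ∏ k, (1 - PowerSeries.C (x k) * PowerSeries.X) := by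
    simp [PZ, map_prod, hφ]
  have hmap : PowerSeries.map φ hZ = h := by
    have h1 := congrArg (PowerSeries.map φ) hhZ
    rw [map_mul, map_one, hP2] at h1
    calc PowerSeries.map φ hZ = PowerSeries.map φ hZ *
        (h * ∏ k, (1 - PowerSeries.C (x k) * PowerSeries.X)) := by rw [hh, mul_one]
      _ = (PowerSeries.map φ hZ * ∏ k, (1 - PowerSeries.C (x k) * PowerSeries.X)) * h := by ring
      _ = h := by rw [h1, one_mul]
  have := congrArg φ key
  rw [map_mul, map_DD, map_FF, map_GG, hmap] at this
  simpa [hφ] using this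

end CF


namespace CF
open Finset

theorem DD_sq {R : Type*} [CommRing R] {M : ℕ} (x : Fin M → R) :
    DD x ^ 2 * ∏ k, (1 + x k) = (∏ k, (1 - x k)) * ∏ k, ∏ l, (1 - x k * x l) := by
  have h1 : ∏ k, ∏ l, (1 - x k * x l) =
      (∏ k, (1 - x k * x k)) * (∏ i, ∏ j, if i < j then 1 - x i * x j else 1) ^ 2 := by
    have h2 : (∏ i, ∏ j, if i < j then 1 - x i * x j else 1) =
        ∏ i, ∏ j, if j < i then 1 - x i * x j else 1 := by
      rw [Finset.prod_comm]
      refine Finset.prod_congr rfl fun i _ => Finset.prod_congr rfl fun j _ => ?_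
      rw [mul_comm]
    have h3 : (∏ k, (1 - x k * x k)) = ∏ i, ∏ j, if i = j then 1 - x i * x j else 1 := by
      refine Finset.prod_congr rfl fun i _ => ?_
      rw [Finset.prod_ite_eq]; simp
    rw [sq]
    nth_rewrite 2 [h2]
    rw [h3, ← Finset.prod_mul_distrib, ← Finset.prod_mul_distrib]
    refine Finset.prod_congr rfl fun i _ => ?_
    rw [← Finset.prod_mul_distrib, ← Finset.prod_mul_distrib]
    refine Finset.prod_congr rfl fun j _ => ?_
    rcases lt_trichotomy i j with h | h | h
    · simp [h, h.not_gt, h.ne]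
    · simp [h]
    · simp [h, h.not_gt, h.ne']
  have h4 : (∏ k, (1 - x k * x k)) = (∏ k, (1 - x k)) * ∏ k, (1 + x k) := by
    rw [← Finset.prod_mul_distrib]
    refine Finset.prod_congr rfl fun i _ => ?_
    ring
  rw [h1, h4]
  unfold DD
  ring

theorem DD_super {Q : Type*} [CommRing Q] {m n M : ℕ} (x : Fin m → Q) (y : Fin n → Q)
    (ξ : Fin M → Q)
    (hpol : (∏ j, (1 + Polynomial.C (y j) * Polynomial.X)) *
      (∏ k, (1 - Polynomial.C (ξ k) * Polynomial.X)) =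
      ∏ i, (1 - Polynomial.C (x i) * Polynomial.X))
    (u1 : IsUnit (∏ k, (1 + ξ k))) (u2 : IsUnit (∏ j, (1 + y j))) (u3 : IsUnit (∏ j, (1 - y j)))
    (u4 : IsUnit (DD ξ * (∏ i, ∏ j, (1 + x i * y j)) + DD x * DD y)) :
    DD ξ * (∏ i, ∏ j, (1 + x i * y j)) = DD x * DD y := by
  have hev : ∀ u : Q, (∏ j, (1 + y j * u)) * (∏ k, (1 - ξ k * u)) = ∏ i, (1 - x i * u) := by
    intro u
    have := congrArg (Polynomial.eval u) hpol
    simpa [Polynomial.eval_mul, Polynomial.eval_prod] using this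
  set W := ∏ i, ∏ j, (1 + x i * y j) with hW
  have hab : (∏ k, ∏ l, (1 - ξ k * ξ l)) * (∏ j, ∏ k, (1 + ξ k * y j)) =
      ∏ i, ∏ k, (1 - ξ k * x i) := by
    rw [Finset.prod_comm (s := univ) (t := univ) (f := fun (i : Fin m) (k : Fin M) => 1 - ξ k * x i),
      Finset.prod_comm (s := univ) (t := univ) (f := fun (j : Fin n) (k : Fin M) => 1 + ξ k * y j),
      ← Finset.prod_mul_distrib]
    refine Finset.prod_congr rfl fun k _ => ?_
    have := hev (ξ k)
    rw [mul_comm]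
    simpa [mul_comm] using this
  have hcW : (∏ i, ∏ k, (1 - ξ k * x i)) * W = ∏ i, ∏ i', (1 - x i * x i') := by
    rw [hW, ← Finset.prod_mul_distrib]
    refine Finset.prod_congr rfl fun i _ => ?_
    have := hev (x i)
    rw [mul_comm]
    simpa [mul_comm] using this
  have hbf : (∏ j, ∏ k, (1 + ξ k * y j)) * (∏ j, ∏ l, (1 - y j * y l)) = W := by
    rw [hW, ← Finset.prod_mul_distrib, Finset.prod_comm]
    refine Finset.prod_congr rfl fun j _ => ?_
    have := hev (- y j)
    rw [mul_comm]
    simpa [mul_comm, sub_eq_add_neg] using this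
  have e1 : (∏ j, (1 + y j)) * (∏ k, (1 - ξ k)) = ∏ i, (1 - x i) := by simpa using hev 1
  have e2 : (∏ j, (1 - y j)) * (∏ k, (1 + ξ k)) = ∏ i, (1 + x i) := by
    simpa [sub_eq_add_neg] using hev (-1)
  have s1 := DD_sq ξ
  have s2 := DD_sq x
  have s3 := DD_sq y
  rw [← e1, ← e2, ← hcW, ← hab] at s2
  have key : (∏ k, (1 + ξ k)) * ((∏ j, (1 + y j)) * ((∏ j, (1 - y j)) *
      ((DD ξ * W) ^ 2 - (DD x * DD y)^2))) = 0 := by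
    generalize (∏ k, (1 + ξ k)) = p1 at *
    generalize (∏ k, (1 - ξ k)) = p2 at *
    generalize (∏ k, (1 + y k)) = p3 at *
    generalize (∏ k, (1 - y k)) = p4 at *
    generalize (∏ j, ∏ k, (1 + ξ k * y j)) = b at *
    generalize (∏ j, ∏ l, (1 - y j * y l)) = f at *
    generalize (∏ k, ∏ l, (1 - ξ k * ξ l)) = a at *
    generalize DD ξ = A at *
    generalize DD x = B at *
    generalize DD y = C at *
    clear_value W
    subst hbf
    linear_combination (p3 * p4 * (b*f)^2) * s1 - C^2 * p3 * s2 - (p3 * p2 * a * b * (b * f)) * s3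
  rw [u1.mul_right_eq_zero, u2.mul_right_eq_zero, u3.mul_right_eq_zero] at key
  have : (DD ξ * W + DD x * DD y) * (DD ξ * W - DD x * DD y) = 0 := by rw [← key]; ring
  rw [u4.mul_right_eq_zero] at this
  exact sub_eq_zero.1 this

theorem abstractQ {Q : Type*} [CommRing Q] {m n M : ℕ} (c : ℕ) (x : Fin m → Q) (y : Fin n → Q)
    (ξ : Fin M → Q)
    (hpol : (∏ j, (1 + Polynomial.C (y j) * Polynomial.X)) *
      (∏ k, (1 - Polynomial.C (ξ k) * Polynomial.X)) =
      ∏ i, (1 - Polynomial.C (x i) * Polynomial.X))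
    (u1 : IsUnit (∏ k, (1 + ξ k))) (u2 : IsUnit (∏ j, (1 + y j))) (u3 : IsUnit (∏ j, (1 - y j)))
    (u4 : IsUnit (DD ξ * (∏ i, ∏ j, (1 + x i * y j)) + DD x * DD y))
    (h : PowerSeries Q)
    (hh : h * ∏ i, (1 - PowerSeries.C (x i) * PowerSeries.X) =
      ∏ j, (1 + PowerSeries.C (y j) * PowerSeries.X)) :
    (∏ i, ∏ j, (1 + x i * y j)) * GG c M h = DD x * DD y * FF c M h := by
  have hps : (∏ j, (1 + PowerSeries.C (y j) * PowerSeries.X)) *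
      (∏ k, (1 - PowerSeries.C (ξ k) * PowerSeries.X)) =
      ∏ i, (1 - PowerSeries.C (x i) * PowerSeries.X) := by
    have := congrArg Polynomial.coeToPowerSeries.ringHom hpol
    rw [map_mul, map_prod, map_prod, map_prod] at this
    simpa using this
  have hu : IsUnit (∏ j, (1 + PowerSeries.C (y j) * PowerSeries.X) : PowerSeries Q) := by
    rw [PowerSeries.isUnit_iff_constantCoeff]
    simp [map_prod]
  have hP : h * ∏ k, (1 - PowerSeries.C (ξ k) * PowerSeries.X) = 1 := by
    apply hu.mul_left_cancel
    rw [← hps] at hh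
    linear_combination hh
  rw [← DD_super x y ξ hpol u1 u2 u3 u4, ← FG c M ξ h hP]
  ring

end CF


namespace CF
open Finset

theorem split_poly {K : Type*} [Field K] [IsAlgClosed K] : ∀ (M : ℕ) (E : Polynomial K),
    E.natDegree ≤ M → E.coeff 0 = 1 →
    ∃ ξ : Fin M → K, E = ∏ k, (1 - Polynomial.C (ξ k) * Polynomial.X) := by
  intro M
  induction M with
  | zero =>
    intro E hd h0
    refine ⟨Fin.elim0, ?_⟩
    rw [Polynomial.eq_C_of_natDegree_le_zero hd, h0]
    simp
  | succ M ih =>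
    intro E hd h0
    by_cases hE : E.natDegree ≤ M
    · obtain ⟨ξ, hξ⟩ := ih E hE h0
      refine ⟨Fin.cons 0 ξ, ?_⟩
      rw [Fin.prod_univ_succ]
      simpa using hξ
    · have hdeg : E.degree ≠ 0 := by
        intro h
        have := Polynomial.natDegree_eq_zero_iff_degree_le_zero.2 h.le
        omega
      obtain ⟨r, hr⟩ := IsAlgClosed.exists_root E hdeg
      obtain ⟨q, hq⟩ := Polynomial.dvd_iff_isRoot.2 hr
      have hE0 : E ≠ 0 := by rintro rfl; simp at h0
      have hq0 : q ≠ 0 := by rintro rfl; simp [hq] at hE0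
      have hqc : -r * q.coeff 0 = 1 := by
        rw [← h0, hq, Polynomial.mul_coeff_zero]; simp
      have hr0 : r ≠ 0 := by rintro rfl; simp at hqc
      have hqd : q.natDegree ≤ M := by
        have := Polynomial.natDegree_mul (Polynomial.X_sub_C_ne_zero r) hq0
        rw [← hq, Polynomial.natDegree_X_sub_C] at this
        omega
      obtain ⟨ξ, hξ⟩ := ih (Polynomial.C (-r) * q)
        ((Polynomial.natDegree_C_mul_le _ _).trans hqd) (by rw [Polynomial.coeff_C_mul, hqc])
      refine ⟨Fin.cons r⁻¹ ξ, ?_⟩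
      rw [Fin.prod_univ_succ]
      simp only [Fin.cons_zero, Fin.cons_succ]
      rw [← hξ, hq, ← mul_assoc]
      congr 1
      have : Polynomial.C r⁻¹ * Polynomial.C r = (1 : Polynomial K) := by
        rw [← Polynomial.C_mul, inv_mul_cancel₀ hr0, Polynomial.C_1]
      rw [map_neg]
      linear_combination (-Polynomial.X) * this

theorem split_super {K : Type*} [Field K] [IsAlgClosed K] {m n : ℕ} (M : ℕ) (x : Fin m → K)
    (y : Fin n → K) : ∃ ξ : Fin M → K, ∀ d ≤ M,
      ((∏ j, (1 + Polynomial.C (y j) * Polynomial.X)) *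
      (∏ k, (1 - Polynomial.C (ξ k) * Polynomial.X))).coeff d =
      (∏ i, (1 - Polynomial.C (x i) * Polynomial.X)).coeff d := by
  let Y : Polynomial K := ∏ j, (1 + Polynomial.C (y j) * Polynomial.X)
  let X : Polynomial K := ∏ i, (1 - Polynomial.C (x i) * Polynomial.X)
  have hY0 : PowerSeries.constantCoeff (Y : PowerSeries K) = 1 := by
    rw [← PowerSeries.coeff_zero_eq_constantCoeff_apply, Polynomial.coeff_coe,
      Polynomial.coeff_zero_eq_eval_zero, Polynomial.eval_prod]
    simp
  have hX0 : PowerSeries.constantCoeff (X : PowerSeries K) = 1 := by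
    rw [← PowerSeries.coeff_zero_eq_constantCoeff_apply, Polynomial.coeff_coe,
      Polynomial.coeff_zero_eq_eval_zero, Polynomial.eval_prod]
    simp
  let F : PowerSeries K := (X : PowerSeries K) * PowerSeries.invOfUnit Y 1
  have hF : (Y : PowerSeries K) * F = X := by
    have := PowerSeries.mul_invOfUnit (Y : PowerSeries K) 1 (by simp [hY0])
    calc (Y : PowerSeries K) * F = (X : PowerSeries K) * ((Y : PowerSeries K) * PowerSeries.invOfUnit (Y : PowerSeries K) 1) := by simp only [F]; ring
      _ = X := by rw [this, mul_one]
  let E := PowerSeries.trunc (M+1) F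
  have hEd : E.natDegree ≤ M := by
    have := PowerSeries.natDegree_trunc_lt F M
    exact Nat.lt_succ_iff.1 this
  have hE0 : E.coeff 0 = 1 := by
    have h1 := congrArg PowerSeries.constantCoeff hF
    rw [map_mul, hY0, hX0, one_mul] at h1
    simp only [E]
    rw [PowerSeries.coeff_trunc]
    simpa using h1
  obtain ⟨ξ, hξ⟩ := split_poly M E hEd hE0
  refine ⟨ξ, fun d hd => ?_⟩
  rw [← hξ]
  change (Y * E).coeff d = X.coeff d
  rw [← Polynomial.coeff_coe, ← Polynomial.coeff_coe, ← hF, Polynomial.coe_mul,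
    PowerSeries.coeff_mul, PowerSeries.coeff_mul]
  refine Finset.sum_congr rfl fun q hq => ?_
  rw [HasAntidiagonal.mem_antidiagonal] at hq
  congr 1
  rw [Polynomial.coeff_coe]
  simp only [E]
  rw [PowerSeries.coeff_trunc, if_pos (by omega)]

/-- the ring `K[[t]]/(t^{M+1})` -/
abbrev QQ (K : Type*) [Field K] (M : ℕ) :=
  PowerSeries K ⧸ Ideal.span {(PowerSeries.X : PowerSeries K) ^ (M+1)}

noncomputable def pq (K : Type*) [Field K] (M : ℕ) : PowerSeries K →+* QQ K M :=
  Ideal.Quotient.mk _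

theorem pq_eq {K : Type*} [Field K] {M : ℕ} (f g : PowerSeries K) :
    pq K M f = pq K M g ↔ ∀ d ≤ M, PowerSeries.coeff d f = PowerSeries.coeff d g := by
  unfold pq
  rw [Ideal.Quotient.eq, Ideal.mem_span_singleton, PowerSeries.X_pow_dvd_iff]
  simp only [map_sub, sub_eq_zero, Nat.lt_succ_iff]

theorem pq_unit {K : Type*} [Field K] {M : ℕ} (f : PowerSeries K)
    (h : PowerSeries.constantCoeff f ≠ 0) : IsUnit (pq K M f) := by
  apply IsUnit.map
  rw [PowerSeries.isUnit_iff_constantCoeff]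
  exact h.isUnit

theorem coeff_scale {K Q : Type*} [CommRing K] [CommRing Q] (ρ : K →+* Q) (τ : Q)
    (A : Polynomial K) (d : ℕ) :
    (Polynomial.eval₂RingHom (Polynomial.C.comp ρ) (Polynomial.C τ * Polynomial.X) A).coeff d =
      ρ (A.coeff d) * τ ^ d := by
  induction A using Polynomial.induction_on' with
  | add p q hp hq => rw [map_add, Polynomial.coeff_add, hp, hq, Polynomial.coeff_add, map_add,
      add_mul]
  | monomial k a =>
    rw [Polynomial.coe_eval₂RingHom, Polynomial.eval₂_monomial, mul_pow, ← Polynomial.C_pow,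
      RingHom.comp_apply, ← mul_assoc, ← Polynomial.C_mul, Polynomial.coeff_C_mul_X_pow,
      Polynomial.coeff_monomial]
    split_ifs with h1 h2 h2
    · rw [h1]
    · exact absurd h1.symm h2
    · exact absurd h2.symm h1
    · simp

theorem quot_super {K : Type*} [Field K] [IsAlgClosed K] [CharZero K] {m n : ℕ} (M c : ℕ)
    (x : Fin m → K) (y : Fin n → K)
    (h : PowerSeries (QQ K M))
    (hh : h * ∏ i, (1 - PowerSeries.C (pq K M (PowerSeries.C (x i) * PowerSeries.X)) * PowerSeries.X) =
      ∏ j, (1 + PowerSeries.C (pq K M (PowerSeries.C (y j) * PowerSeries.X)) * PowerSeries.X)) :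
    (∏ i, ∏ j, (1 + pq K M (PowerSeries.C (x i) * PowerSeries.X) *
      pq K M (PowerSeries.C (y j) * PowerSeries.X))) * GG c M h =
      DD (fun i => pq K M (PowerSeries.C (x i) * PowerSeries.X)) *
      DD (fun j => pq K M (PowerSeries.C (y j) * PowerSeries.X)) * FF c M h := by
  obtain ⟨ξ, hξ⟩ := split_super M x y
  let τ := pq K M PowerSeries.X
  have hτ : ∀ d, M < d → τ ^ d = 0 := by
    intro d hd
    rw [← map_pow, ← map_zero (pq K M), pq_eq]
    intro e he
    rw [PowerSeries.coeff_X_pow, if_neg (by omega), map_zero]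
  let s : Polynomial K →+* Polynomial (QQ K M) :=
    Polynomial.eval₂RingHom (Polynomial.C.comp ((pq K M).comp PowerSeries.C))
      (Polynomial.C τ * Polynomial.X)
  have hsC : ∀ a, s (Polynomial.C a) = Polynomial.C (pq K M (PowerSeries.C a)) := by
    intro a; simp [s]
  have hsX : s Polynomial.X = Polynomial.C τ * Polynomial.X := by simp [s]
  have hs : ∀ A d, (s A).coeff d = pq K M (PowerSeries.C (A.coeff d)) * τ ^ d := 
    coeff_scale ((pq K M).comp PowerSeries.C) τ
  apply abstractQ c _ _ (fun k => pq K M (PowerSeries.C (ξ k) * PowerSeries.X))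
  · have e : s ((∏ j, (1 + Polynomial.C (y j) * Polynomial.X)) *
      (∏ k, (1 - Polynomial.C (ξ k) * Polynomial.X))) =
      s (∏ i, (1 - Polynomial.C (x i) * Polynomial.X)) := by
      ext d
      rw [hs, hs]
      by_cases hd : d ≤ M
      · rw [hξ d hd]
      · rw [hτ d (by omega), mul_zero, mul_zero]
    rw [map_mul, map_prod, map_prod, map_prod] at e
    simp only [map_add, map_sub, map_one, map_mul, hsC, hsX] at e
    simp only [map_mul, mul_assoc]
    exact e
  · simp only [← map_one (pq K M), ← map_add, ← map_prod]
    apply pq_unit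
    simp [map_prod]
  · simp only [← map_one (pq K M), ← map_add, ← map_prod]
    apply pq_unit
    simp [map_prod]
  · simp only [← map_one (pq K M), ← map_sub, ← map_prod]
    apply pq_unit
    simp [map_prod]
  · rw [← map_DD (pq K M) (fun k => PowerSeries.C (ξ k) * PowerSeries.X),
      ← map_DD (pq K M) (fun k => PowerSeries.C (x k) * PowerSeries.X),
      ← map_DD (pq K M) (fun k => PowerSeries.C (y k) * PowerSeries.X)]
    simp only [← map_one (pq K M), ← map_add, ← map_prod, ← map_mul]
    apply pq_unit
    rw [map_add, map_mul, map_mul, map_DD, map_DD, map_DD]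
    have h0 : ∀ a, DD (fun _ : Fin a => (0:K)) = 1 := by intro a; simp [DD]
    simp [map_prod, h0]
  · exact hh

theorem main_poly {m n : ℕ} (M c : ℕ)
    (h : PowerSeries (MvPolynomial (Fin m ⊕ Fin n) ℚ))
    (hh : h * ∏ i, (1 - PowerSeries.C (MvPolynomial.X (Sum.inl i)) * PowerSeries.X) =
      ∏ j, (1 + PowerSeries.C (MvPolynomial.X (Sum.inr j)) * PowerSeries.X))
    (e : Fin m ⊕ Fin n →₀ ℕ) (he : e.degree ≤ M) :
    MvPolynomial.coeff e ((∏ i : Fin m, ∏ j : Fin n, (1 + MvPolynomial.X (Sum.inl i) *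
      MvPolynomial.X (Sum.inr j))) * GG c M h) =
    MvPolynomial.coeff e (DD (fun i => MvPolynomial.X (Sum.inl i)) *
      DD (fun j => MvPolynomial.X (Sum.inr j)) * FF c M h) := by
  let A := MvPolynomial (Fin m ⊕ Fin n) ℚ
  let K := AlgebraicClosure (FractionRing A)
  let ι : A →+* K := (algebraMap (FractionRing A) K).comp (algebraMap A (FractionRing A))
  have hι : Function.Injective ι :=
    (algebraMap (FractionRing A) K).injective.comp (IsFractionRing.injective A (FractionRing A))
  haveI : CharZero K := charZero_of_injective_ringHom hι
  let Ψ : A →+* PowerSeries K := MvPolynomial.eval₂Hom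
    ((PowerSeries.C.comp ι).comp MvPolynomial.C) (fun s => PowerSeries.C (ι (MvPolynomial.X s)) * PowerSeries.X)
  have hΨX : ∀ s, Ψ (MvPolynomial.X s) = PowerSeries.C (ι (MvPolynomial.X s)) * PowerSeries.X :=
    fun s => MvPolynomial.eval₂Hom_X' _ _ _
  have hΨC : ∀ s, Ψ (MvPolynomial.C s) = PowerSeries.C (ι (MvPolynomial.C s)) :=
    fun s => MvPolynomial.eval₂Hom_C _ _ _
  have hΨ : ∀ f d, PowerSeries.coeff d (Ψ f) = ι (MvPolynomial.homogeneousComponent d f) := by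
    intro f d
    induction f using MvPolynomial.induction_on' with
    | add p q hp hq => rw [map_add, map_add, map_add, map_add, hp, hq]
    | monomial u a =>
      have h1 : Ψ (MvPolynomial.monomial u a) =
          PowerSeries.C (ι (MvPolynomial.monomial u a)) * PowerSeries.X ^ u.degree := by
        rw [MvPolynomial.monomial_eq, map_mul, hΨC, Finsupp.prod, map_prod]
        simp only [map_pow, hΨX, mul_pow, Finset.prod_mul_distrib]
        rw [Finset.prod_pow_eq_pow_sum]
        simp only [map_mul, map_prod, map_pow]
        rw [mul_assoc]
        rfl
      rw [h1, PowerSeries.coeff_C_mul_X_pow]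
      have hm : (MvPolynomial.monomial u a : A).IsHomogeneous u.degree :=
        MvPolynomial.isHomogeneous_monomial a rfl
      split_ifs with hd
      · rw [MvPolynomial.homogeneousComponent_of_mem hm, if_pos hd]
      · rw [MvPolynomial.homogeneousComponent_of_mem hm, if_neg hd, map_zero]
  let Φ : A →+* QQ K M := (pq K M).comp Ψ
  have key : ∀ f g : A, Φ f = Φ g → MvPolynomial.coeff e f = MvPolynomial.coeff e g := by
    intro f g hfg
    have h1 := (pq_eq _ _).1 hfg _ he
    rw [hΨ, hΨ] at h1
    have h2 := congrArg (MvPolynomial.coeff e) (hι h1)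
    rwa [MvPolynomial.coeff_homogeneousComponent, MvPolynomial.coeff_homogeneousComponent,
      if_pos rfl, if_pos rfl] at h2
  apply key
  have hΦX : ∀ s, Φ (MvPolynomial.X s) = pq K M (PowerSeries.C (ι (MvPolynomial.X s)) * PowerSeries.X) :=
    fun s => congrArg (pq K M) (hΨX s)
  rw [map_mul, map_mul, map_mul, map_DD, map_DD, map_FF, map_GG]
  simp only [map_prod, map_add, map_one, map_mul Φ, hΦX]
  apply quot_super
  have := congrArg (PowerSeries.map Φ) hh
  rw [map_mul, map_prod, map_prod] at this
  simpa only [map_sub, map_add, map_one, map_mul (PowerSeries.map Φ), PowerSeries.map_C, PowerSeries.map_X, hΦX] using this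

end CF


namespace CF
open Finset

theorem exists_YD (a : ℕ → ℕ) (ha : Antitone a) (M : ℕ) (hM : a M = 0) :
    ∃ μ : YoungDiagram, ∀ i, μ.rowLen i = a i := by
  have hlow : IsLowerSet (((range M ×ˢ range (a 0)).filter fun q => q.2 < a q.1 : Finset (ℕ × ℕ)) :
      Set (ℕ × ℕ)) := by
    rintro ⟨i, j⟩ ⟨i', j'⟩ hle h
    simp only [Prod.mk_le_mk] at hle
    simp only [mem_coe, mem_filter, mem_product, mem_range] at h ⊢
    have := ha hle.1
    omega
  refine ⟨⟨_, hlow⟩, ?_⟩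
  · intro i
    have key : ∀ j, j < YoungDiagram.rowLen ⟨_, hlow⟩ i
        ↔ j < a i := by
      intro j
      rw [← YoungDiagram.mem_iff_lt_rowLen, YoungDiagram.mem_mk]
      simp only [mem_filter, mem_product, mem_range]
      refine ⟨fun h => h.2, fun h => ⟨⟨?_, ?_⟩, h⟩⟩
      · by_contra hi
        have := ha (not_lt.1 hi)
        omega
      · have := ha (Nat.zero_le i)
        omega
    apply le_antisymm
    · by_contra hlt
      have := (key (a i)).1 (not_le.1 hlt)
      omega
    · by_contra hlt
      have := (key _).2 (not_le.1 hlt)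
      omega

theorem YD_ext {μ ν : YoungDiagram} (h : ∀ i, μ.rowLen i = ν.rowLen i) : μ = ν := by
  apply SetLike.ext
  rintro ⟨i, j⟩
  rw [YoungDiagram.mem_iff_lt_rowLen, YoungDiagram.mem_iff_lt_rowLen, h]

/-- at most `M` rows -/
def Rows (M : ℕ) (μ : YoungDiagram) : Prop := ∀ i, M ≤ i → μ.rowLen i = 0

theorem Rows.mono {M : ℕ} {μ ν : YoungDiagram} (h : Rows M ν) (hle : μ ≤ ν) : Rows M μ := by
  intro i hi
  by_contra hne
  have h1 : (i, 0) ∈ μ := YoungDiagram.mem_iff_lt_rowLen.2 (Nat.pos_of_ne_zero hne)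
  have h2 := YoungDiagram.mem_iff_lt_rowLen.1 (hle h1)
  rw [h i hi] at h2
  omega

theorem le_iff_rowLen {μ ν : YoungDiagram} : μ ≤ ν ↔ ∀ i, μ.rowLen i ≤ ν.rowLen i := by
  constructor
  · intro h i
    by_contra hlt
    have h1 : (i, ν.rowLen i) ∈ μ := YoungDiagram.mem_iff_lt_rowLen.2 (not_le.1 hlt)
    have h2 := YoungDiagram.mem_iff_lt_rowLen.1 (h h1)
    omega
  · rintro h ⟨i, j⟩ hij
    have hij' : (i, j) ∈ μ := hij
    have : (i, j) ∈ ν := by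
      rw [YoungDiagram.mem_iff_lt_rowLen] at hij' ⊢
      exact hij'.trans_le (h i)
    exact this

/-- shifted row lengths in increasing order -/
def lv (M : ℕ) (μ : YoungDiagram) (i : Fin M) : ℕ := μ.rowLen (Fin.rev i) + i

theorem lv_strictMono (M : ℕ) (μ : YoungDiagram) : StrictMono (lv M μ) := by
  intro i j hij
  unfold lv
  have h1 : (Fin.rev j : ℕ) ≤ Fin.rev i := by
    have := Fin.rev_le_rev.2 hij.le
    exact this
  have h2 := μ.rowLen_anti _ _ h1
  have : (i:ℕ) < j := hij
  omega

theorem lv_inj {M : ℕ} {μ ν : YoungDiagram} (hμ : Rows M μ) (hν : Rows M ν)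
    (h : lv M μ = lv M ν) : μ = ν := by
  apply YD_ext
  intro i
  by_cases hi : i < M
  · have := congrFun h (Fin.rev ⟨i, hi⟩)
    unfold lv at this
    rw [Fin.rev_rev] at this
    simpa using this
  · rw [hμ i (by omega), hν i (by omega)]

theorem lv_surj {M : ℕ} (c : Fin M → ℕ) (hc : StrictMono c) :
    ∃ μ : YoungDiagram, Rows M μ ∧ lv M μ = c := by
  have hge : ∀ i : Fin M, (i:ℕ) ≤ c i := by
    rintro ⟨i, hi⟩
    induction i with
    | zero => simp
    | succ i ih =>
      have h1 := ih (by omega)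
      have h2 : c ⟨i, by omega⟩ < c ⟨i+1, hi⟩ := hc (by simp [Fin.lt_def])
      simp only at h1 ⊢
      omega
  let a : ℕ → ℕ := fun k => if h : k < M then c (Fin.rev ⟨k, h⟩) - (Fin.rev ⟨k, h⟩ : ℕ) else 0
  have ha : Antitone a := by
    apply antitone_nat_of_succ_le
    intro k
    simp only [a]
    split_ifs with h1 h2
    · have hlt : c (Fin.rev ⟨k+1, h1⟩) < c (Fin.rev ⟨k, h2⟩) := hc (by simp [Fin.lt_def]; omega)
      have := hge (Fin.rev ⟨k, h2⟩)
      have := hge (Fin.rev ⟨k+1, h1⟩)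
      simp only [Fin.val_rev] at *
      omega
    · omega
    · simp
    · simp
  obtain ⟨μ, hμ⟩ := exists_YD a ha M (by simp [a])
  refine ⟨μ, fun i hi => ?_, ?_⟩
  · rw [hμ]; simp [a]; intro h; omega
  · funext i
    unfold lv
    rw [hμ]
    simp only [a, Fin.is_lt, dif_pos, Fin.eta, Fin.rev_rev]
    have := hge i
    omega

theorem card_eq_rows {M : ℕ} {μ : YoungDiagram} (h : Rows M μ) :
    μ.card = ∑ i : Fin M, μ.rowLen i := by
  rw [← Finset.sum_range (fun i => μ.rowLen i)]
  unfold YoungDiagram.card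
  rw [Finset.card_eq_sum_card_fiberwise (f := Prod.fst) (t := range M)]
  · refine Finset.sum_congr rfl fun i _ => ?_
    rw [YoungDiagram.rowLen_eq_card]; rfl
  · rintro ⟨i, j⟩ hc
    simp only [coe_range, Set.mem_Iio]
    by_contra hi
    have h1 : (i, j) ∈ μ := hc
    rw [YoungDiagram.mem_iff_lt_rowLen, h i (by omega)] at h1
    omega

theorem card_add {M : ℕ} {μ : YoungDiagram} (h : Rows M μ) :
    ∑ i, lv M μ i = μ.card + ∑ i : Fin M, (i:ℕ) := by
  unfold lv
  rw [Finset.sum_add_distrib, card_eq_rows h]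
  congr 1
  exact Equiv.sum_comp Fin.revPerm (fun i : Fin M => μ.rowLen i)

/-- row vector -/
noncomputable def wr {R : Type*} [CommRing R] (M : ℕ) (h : PowerSeries R) (l : ℕ) : Fin M → R :=
  fun r => PowerSeries.coeff l (PowerSeries.X ^ (r:ℕ) * h)

theorem jt_expand {R : Type*} [CommRing R] {M : ℕ} (h : PowerSeries R) (z : R)
    (l : Fin M → ℕ) (I : Fin M → Finset ℕ) :
    Matrix.det (Matrix.of fun a : Fin M => ∑ c ∈ I a, z ^ (l a - c) • wr M h c) =
      ∑ c ∈ Fintype.piFinset I, z ^ (∑ a, (l a - c a)) * jt h c := by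
  have := (Matrix.detRowAlternating (R := R) (n := Fin M)).toMultilinearMap.map_sum_finset
    (fun a c => z ^ (l a - c) • wr M h c) I
  refine this.trans ?_
  refine Finset.sum_congr rfl fun c _ => ?_
  rw [MultilinearMap.map_smul_univ, Finset.prod_pow_eq_pow_sum, smul_eq_mul]
  rfl

theorem wr_H {R : Type*} [CommRing R] {M : ℕ} (h h' : PowerSeries R) (z : R)
    (hh : h' * (1 - PowerSeries.C z * PowerSeries.X) = h) (l : ℕ) :
    wr M h' (l+1) = wr M h (l+1) + z • wr M h' l := by
  funext r
  unfold wr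
  simp only [Pi.add_apply, Pi.smul_apply, smul_eq_mul]
  have : PowerSeries.X ^ (r:ℕ) * h' = PowerSeries.X ^ (r:ℕ) * h +
      PowerSeries.C z * ((PowerSeries.X ^ (r:ℕ) * h') * PowerSeries.X) := by
    rw [← hh]; ring
  conv_lhs => rw [this]
  rw [map_add, PowerSeries.coeff_C_mul, PowerSeries.coeff_succ_mul_X]

theorem wr_H0 {R : Type*} [CommRing R] {M : ℕ} (h h' : PowerSeries R) (z : R)
    (hh : h' * (1 - PowerSeries.C z * PowerSeries.X) = h) :
    wr M h' 0 = wr M h 0 := by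
  funext r
  unfold wr
  have : PowerSeries.X ^ (r:ℕ) * h' = PowerSeries.X ^ (r:ℕ) * h +
      PowerSeries.C z * ((PowerSeries.X ^ (r:ℕ) * h') * PowerSeries.X) := by
    rw [← hh]; ring
  conv_lhs => rw [this]
  simp

theorem wr_Hsum {R : Type*} [CommRing R] {M : ℕ} (h h' : PowerSeries R) (z : R)
    (hh : h' * (1 - PowerSeries.C z * PowerSeries.X) = h) (a b : ℕ) (hab : a ≤ b) :
    wr M h' b = (∑ c ∈ Ioc a b, z ^ (b - c) • wr M h c) + z ^ (b - a) • wr M h' a := by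
  induction b, hab using Nat.le_induction with
  | base => simp
  | succ b hab ih =>
    rw [wr_H h h' z hh b, ih, ← Finset.insert_Ioc_right_eq_Ioc_add_one (by omega), Finset.sum_insert (by simp)]
    rw [smul_add, Finset.smul_sum, smul_smul, ← pow_succ', Nat.sub_self, pow_zero, one_smul, add_assoc,
      show b + 1 - a = b - a + 1 by omega]
    congr 2
    refine Finset.sum_congr rfl fun c hc => ?_
    rw [mem_Ioc] at hc
    rw [smul_smul, ← pow_succ', show b + 1 - c = b - c + 1 by omega]

theorem wr_Hsum0 {R : Type*} [CommRing R] {M : ℕ} (h h' : PowerSeries R) (z : R)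
    (hh : h' * (1 - PowerSeries.C z * PowerSeries.X) = h) (b : ℕ) :
    wr M h' b = ∑ c ∈ Icc 0 b, z ^ (b - c) • wr M h c := by
  rw [wr_Hsum h h' z hh 0 b (Nat.zero_le b), wr_H0 h h' z hh, ← Finset.Ioc_insert_left (Nat.zero_le b),
    Finset.sum_insert (by simp), add_comm]

theorem wr_V {R : Type*} [CommRing R] {M : ℕ} (h h' : PowerSeries R) (z : R)
    (hh : h' = h * (1 + PowerSeries.C z * PowerSeries.X)) (b : ℕ) :
    wr M h' b = ∑ c ∈ Icc (b-1) b, z ^ (b - c) • wr M h c := by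
  have : ∀ r : Fin M, PowerSeries.X ^ (r:ℕ) * h' = PowerSeries.X ^ (r:ℕ) * h +
      PowerSeries.C z * ((PowerSeries.X ^ (r:ℕ) * h) * PowerSeries.X) := by
    intro r
    rw [hh]; ring
  cases b with
  | zero =>
    funext r
    simp [wr, this]
  | succ b =>
    have h1 : Icc (b + 1 - 1) (b+1) = {b, b+1} := by
      ext; simp; omega
    rw [h1, Finset.sum_pair (by omega)]
    funext r
    unfold wr
    rw [this, map_add, PowerSeries.coeff_C_mul, PowerSeries.coeff_succ_mul_X]
    simp
    ring

def IH {M : ℕ} (l : Fin (M+1) → ℕ) (i : Fin (M+1)) : Finset ℕ :=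
  Fin.cases (Icc 0 (l 0)) (fun i => Ioc (l i.castSucc) (l i.succ)) i

theorem jt_H {R : Type*} [CommRing R] {M : ℕ} (h h' : PowerSeries R) (z : R)
    (hh : h' * (1 - PowerSeries.C z * PowerSeries.X) = h) (l : Fin (M+1) → ℕ) (hl : StrictMono l) :
    jt h' l = ∑ c ∈ Fintype.piFinset (IH l), z ^ (∑ a, (l a - c a)) * jt h c := by
  rw [← jt_expand]
  unfold jt
  apply Matrix.det_eq_of_forall_row_eq_smul_add_pred (fun i => z ^ (l i.succ - l i.castSucc))
  · intro j
    have := congrFun (wr_Hsum0 (M := M+1) h h' z hh (l 0)) j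
    exact this
  · intro i j
    have := congrFun (wr_Hsum (M := M+1) h h' z hh (l i.castSucc) (l i.succ)
      (hl Fin.castSucc_lt_succ).le) j
    exact this

theorem jt_V {R : Type*} [CommRing R] {M : ℕ} (h h' : PowerSeries R) (z : R)
    (hh : h' = h * (1 + PowerSeries.C z * PowerSeries.X)) (l : Fin (M+1) → ℕ) (hl : StrictMono l) :
    jt h' l = ∑ c ∈ (Fintype.piFinset (fun i => Icc (l i - 1) (l i))).filter StrictMono,
      z ^ (∑ a, (l a - c a)) * jt h c := by
  rw [Finset.sum_filter_of_ne, ← jt_expand]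
  · unfold jt
    congr 1
    ext a r
    exact congrFun (wr_V (M := M+1) h h' z hh (l a)) r
  · intro c hc hne
    rw [Fintype.mem_piFinset] at hc
    by_contra hns
    rw [Fin.strictMono_iff_lt_succ] at hns
    push Not at hns
    obtain ⟨i, hi⟩ := hns
    apply hne
    have h1 := hc i.castSucc
    have h2 := hc i.succ
    rw [mem_Icc] at h1 h2
    have h3 : l i.castSucc < l i.succ := hl Fin.castSucc_lt_succ
    have heq : c i.castSucc = c i.succ := by omega
    have : jt h c = 0 := by
      unfold jt
      apply Matrix.det_zero_of_row_eq (i := i.castSucc) (j := i.succ) Fin.castSucc_lt_succ.ne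
      funext r
      simp [heq]
    rw [this, mul_zero]

theorem finite_below (lam : YoungDiagram) : (Set.Iic lam).Finite := by
  apply Set.Finite.of_finite_image (f := fun μ : YoungDiagram => μ.cells)
  · apply Set.Finite.subset (Finset.finite_toSet lam.cells.powerset)
    rintro _ ⟨μ, hμ, rfl⟩
    simp only [coe_powerset]
    exact fun c hc => YoungDiagram.cells_subset_iff.2 hμ hc
  · intro μ _ ν _ h
    exact YoungDiagram.ext h

noncomputable def below (lam : YoungDiagram) : Finset YoungDiagram := (finite_below lam).toFinset

@[simp] theorem mem_below {lam μ : YoungDiagram} : μ ∈ below lam ↔ μ ≤ lam := by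
  simp [below]

def HS (lam μ : YoungDiagram) : Prop := ∀ i j, (i+1, j) ∈ lam → (i, j) ∈ μ
def VS (lam μ : YoungDiagram) : Prop := ∀ i j, (i, j+1) ∈ lam → (i, j) ∈ μ

theorem HS_iff {lam μ : YoungDiagram} : HS lam μ ↔ ∀ i, lam.rowLen (i+1) ≤ μ.rowLen i := by
  constructor
  · intro h i
    by_contra hlt
    have h2 := h i (μ.rowLen i) (YoungDiagram.mem_iff_lt_rowLen.2 (not_le.1 hlt))
    rw [YoungDiagram.mem_iff_lt_rowLen] at h2
    omega
  · intro h i j hij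
    rw [YoungDiagram.mem_iff_lt_rowLen] at hij ⊢
    exact hij.trans_le (h i)

theorem VS_iff {lam μ : YoungDiagram} : VS lam μ ↔ ∀ i, lam.rowLen i - 1 ≤ μ.rowLen i := by
  constructor
  · intro h i
    by_contra hlt
    have h2 := h i (μ.rowLen i) (YoungDiagram.mem_iff_lt_rowLen.2 (by omega))
    rw [YoungDiagram.mem_iff_lt_rowLen] at h2
    omega
  · intro h i j hij
    rw [YoungDiagram.mem_iff_lt_rowLen] at hij ⊢
    have := h i
    omega

theorem VS_transpose {lam μ : YoungDiagram} : HS lam.transpose μ.transpose ↔ VS lam μ := by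
  unfold HS VS
  simp only [YoungDiagram.mem_transpose, Prod.swap]
  exact ⟨fun h i j => h j i, fun h i j => h j i⟩

theorem sum_sub_lv {M : ℕ} {lam μ : YoungDiagram} (hl : Rows M lam) (hle : μ ≤ lam) :
    ∑ a, (lv M lam a - lv M μ a) = lam.card - μ.card := by
  rw [Finset.sum_tsub_distrib]
  · rw [card_add hl, card_add (hl.mono hle)]
    omega
  · intro a _
    unfold lv
    have := le_iff_rowLen.1 hle (Fin.rev a)
    omega

open Classical in
theorem branch_H {R : Type*} [CommRing R] {M : ℕ} (h h' : PowerSeries R) (z : R)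
    (hh : h' * (1 - PowerSeries.C z * PowerSeries.X) = h) (lam : YoungDiagram)
    (hl : Rows (M+1) lam) :
    jt h' (lv (M+1) lam) = ∑ μ ∈ (below lam).filter (HS lam),
      z ^ (lam.card - μ.card) * jt h (lv (M+1) μ) := by
  rw [jt_H h h' z hh _ (lv_strictMono _ _)]
  symm
  have mem : ∀ μ, Rows (M+1) μ → ((μ ≤ lam ∧ HS lam μ) ↔ ∀ a, lv (M+1) μ a ∈ IH (lv (M+1) lam) a) := by
    intro μ hμ
    rw [le_iff_rowLen, HS_iff]
    have r0 : ((Fin.rev (0 : Fin (M+1)) : Fin (M+1)) : ℕ) = M := by simp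
    have rs : ∀ i : Fin M, ((Fin.rev i.succ : Fin (M+1)) : ℕ) + 1 = Fin.rev i.castSucc := by
      intro i; simp [Fin.val_rev]; omega
    constructor
    · rintro ⟨h1, h2⟩ a
      refine Fin.cases ?_ (fun i => ?_) a
      · simp only [IH, Fin.cases_zero, mem_Icc, lv]
        exact ⟨Nat.zero_le _, Nat.add_le_add_right (h1 _) _⟩
      · simp only [IH, Fin.cases_succ, mem_Ioc, lv]
        have e1 := h1 (Fin.rev i.succ : Fin (M+1))
        have e2 := h2 (Fin.rev i.succ : Fin (M+1))
        rw [rs] at e2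
        simp only [Fin.val_castSucc, Fin.val_succ] at *
        omega
    · intro h0
      constructor
      · intro k
        by_cases hk : k < M + 1
        · have := h0 (Fin.rev ⟨k, hk⟩)
          have hle : lv (M+1) μ (Fin.rev ⟨k, hk⟩) ≤ lv (M+1) lam (Fin.rev ⟨k, hk⟩) := by
            revert this
            generalize Fin.rev (⟨k, hk⟩ : Fin (M+1)) = a
            refine Fin.cases ?_ (fun i => ?_) a
            · simp only [IH, Fin.cases_zero, mem_Icc]; exact fun h => h.2
            · simp only [IH, Fin.cases_succ, mem_Ioc]; exact fun h => h.2
          unfold lv at hle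
          rw [Fin.rev_rev] at hle
          simp only at hle
          omega
        · rw [hμ k (by omega)]; omega
      · intro k
        by_cases hk : k < M
        · have := h0 (Fin.succ (Fin.rev ⟨k, hk⟩))
          simp only [IH, Fin.cases_succ, mem_Ioc, lv] at this
          rw [← rs] at this
          have e : ((Fin.rev (Fin.succ (Fin.rev ⟨k, hk⟩)) : Fin (M+1)) : ℕ) = k := by
            simp [Fin.val_rev]; omega
          rw [e] at this
          simp only [Fin.val_castSucc, Fin.val_succ] at this
          omega
        · rw [hl (k+1) (by omega)]; omega
  have smono : ∀ c ∈ Fintype.piFinset (IH (lv (M+1) lam)), StrictMono c := by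
    intro c hc
    rw [Fintype.mem_piFinset] at hc
    rw [Fin.strictMono_iff_lt_succ]
    intro i
    have h1 := hc i.succ
    simp only [IH, Fin.cases_succ, mem_Ioc] at h1
    have h2 : c i.castSucc ≤ lv (M+1) lam i.castSucc := by
      have := hc i.castSucc
      revert this
      generalize i.castSucc = a
      refine Fin.cases ?_ (fun i => ?_) a
      · simp only [IH, Fin.cases_zero, mem_Icc]; exact fun h => h.2
      · simp only [IH, Fin.cases_succ, mem_Ioc]; exact fun h => h.2
    omega
  refine Finset.sum_bij (fun μ _ => lv (M+1) μ) ?_ ?_ ?_ ?_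
  · intro μ hμ
    rw [mem_filter, mem_below] at hμ
    rw [Fintype.mem_piFinset]
    exact (mem μ (hl.mono hμ.1)).1 hμ
  · intro μ hμ ν hν he
    rw [mem_filter, mem_below] at hμ hν
    exact lv_inj (hl.mono hμ.1) (hl.mono hν.1) he
  · intro c hc
    obtain ⟨μ, h1, rfl⟩ := lv_surj c (smono c hc)
    refine ⟨μ, ?_, rfl⟩
    rw [mem_filter, mem_below]
    exact (mem μ h1).2 (Fintype.mem_piFinset.1 hc)
  · intro μ hμ
    rw [mem_filter, mem_below] at hμ
    rw [sum_sub_lv hl hμ.1]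

open Classical in
theorem branch_V {R : Type*} [CommRing R] {M : ℕ} (h h' : PowerSeries R) (z : R)
    (hh : h' = h * (1 + PowerSeries.C z * PowerSeries.X)) (lam : YoungDiagram)
    (hl : Rows (M+1) lam) :
    jt h' (lv (M+1) lam) = ∑ μ ∈ (below lam).filter (VS lam),
      z ^ (lam.card - μ.card) * jt h (lv (M+1) μ) := by
  rw [jt_V h h' z hh _ (lv_strictMono _ _)]
  symm
  have mem : ∀ μ, Rows (M+1) μ → ((μ ≤ lam ∧ VS lam μ) ↔
      ∀ a, lv (M+1) μ a ∈ Icc (lv (M+1) lam a - 1) (lv (M+1) lam a)) := by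
    intro μ hμ
    rw [le_iff_rowLen, VS_iff]
    simp only [mem_Icc, lv]
    constructor
    · rintro ⟨h1, h2⟩ a
      have e1 := h1 (Fin.rev a)
      have e2 := h2 (Fin.rev a)
      omega
    · intro h0
      constructor
      · intro k
        by_cases hk : k < M + 1
        · have := h0 (Fin.rev ⟨k, hk⟩)
          rw [Fin.rev_rev] at this
          simp only at this
          omega
        · rw [hμ k (by omega)]; omega
      · intro k
        by_cases hk : k < M + 1
        · have := h0 (Fin.rev ⟨k, hk⟩)
          rw [Fin.rev_rev] at this
          simp only at this
          omega
        · rw [hl k (by omega)]; omega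
  refine Finset.sum_bij (fun μ _ => lv (M+1) μ) ?_ ?_ ?_ ?_
  · intro μ hμ
    rw [mem_filter, mem_below] at hμ
    rw [mem_filter, Fintype.mem_piFinset]
    exact ⟨(mem μ (hl.mono hμ.1)).1 hμ, lv_strictMono _ _⟩
  · intro μ hμ ν hν he
    rw [mem_filter, mem_below] at hμ hν
    exact lv_inj (hl.mono hμ.1) (hl.mono hν.1) he
  · intro c hc
    rw [mem_filter] at hc
    obtain ⟨μ, h1, rfl⟩ := lv_surj c hc.2
    refine ⟨μ, ?_, rfl⟩
    rw [mem_filter, mem_below]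
    exact (mem μ h1).2 (Fintype.mem_piFinset.1 hc.1)
  · intro μ hμ
    rw [mem_filter, mem_below] at hμ
    rw [sum_sub_lv hl hμ.1]

end CF


namespace CF
open Finset

theorem finite_tabs (m : ℕ) (lam tau : YoungDiagram) : {T | IsSkewSSYT m lam tau T}.Finite := by
  classical
  refine (Set.finite_range (fun f : ((lam.cells \ tau.cells : Finset (ℕ × ℕ)) → Fin m) =>
    fun i j => if h : (i, j) ∈ lam.cells \ tau.cells then ((f ⟨(i, j), h⟩ : Fin m) : ℕ) else 0)).subset ?_
  rintro T ⟨h1, _, _, h4⟩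
  refine ⟨fun c => ⟨T c.1.1 c.1.2, h1 _ _ c.2⟩, ?_⟩
  funext i j
  by_cases h : (i, j) ∈ lam.cells \ tau.cells
  · simp only [dif_pos h]
  · simp only [dif_neg h, h4 i j h]

noncomputable def tabs (m : ℕ) (lam tau : YoungDiagram) : Finset (ℕ → ℕ → ℕ) :=
  (finite_tabs m lam tau).toFinset

@[simp] theorem mem_tabs {m : ℕ} {lam tau : YoungDiagram} {T : ℕ → ℕ → ℕ} :
    T ∈ tabs m lam tau ↔ IsSkewSSYT m lam tau T := by
  simp [tabs]

noncomputable def skewS {R : Type*} [CommRing R] (m : ℕ) (x : ℕ → R) (lam tau : YoungDiagram) : R :=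
  ∑ T ∈ tabs m lam tau, ∏ c ∈ lam.cells \ tau.cells, x (T c.1 c.2)

theorem skewS_zero {R : Type*} [CommRing R] (x : ℕ → R) (lam tau : YoungDiagram) (h : tau ≤ lam)
    [Decidable (tau = lam)] :
    skewS 0 x lam tau = if tau = lam then 1 else 0 := by
  unfold skewS
  split_ifs with he
  · subst he
    have : tabs 0 tau tau = {fun _ _ => 0} := by
      ext T
      rw [mem_tabs, mem_singleton]
      constructor
      · rintro ⟨_, _, _, h4⟩
        funext i j
        exact h4 i j (by simp)
      · rintro rfl
        refine ⟨?_, ?_, ?_, ?_⟩ <;> simp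
    rw [this, sum_singleton, sdiff_self]
    rfl
  · have : tabs 0 lam tau = ∅ := by
      apply Finset.eq_empty_of_forall_notMem
      intro T hT
      rw [mem_tabs] at hT
      apply he
      apply le_antisymm h
      rintro ⟨i, j⟩ hc
      by_contra hn
      have hc' : (i, j) ∈ lam := hc
      have hn' : (i, j) ∉ tau := hn
      have := hT.1 i j (by simp [hc', hn'])
      omega
    rw [this, sum_empty]

def extT (m : ℕ) (lam μ : YoungDiagram) (T : ℕ → ℕ → ℕ) : ℕ → ℕ → ℕ :=
  fun i j => if (i, j) ∈ lam ∧ (i, j) ∉ μ then m else T i j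

theorem extT_ssyt {m : ℕ} {lam μ tau : YoungDiagram} (h1 : μ ≤ lam) (h2 : HS lam μ) (h3 : tau ≤ μ)
    {T : ℕ → ℕ → ℕ} (hT : IsSkewSSYT m μ tau T) : IsSkewSSYT (m+1) lam tau (extT m lam μ T) := by
  have hm : ∀ c, c ∈ μ → c ∈ lam := fun c hc => h1 hc
  have ht : ∀ c, c ∈ tau → c ∈ μ := fun c hc => h3 hc
  obtain ⟨t1, t2, t3, t4⟩ := hT
  simp only [mem_sdiff, YoungDiagram.mem_cells] at t1 t2 t3 t4
  refine ⟨?_, ?_, ?_, ?_⟩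
  all_goals simp only [mem_sdiff, YoungDiagram.mem_cells]
  · rintro i j ⟨ha, hb⟩
    unfold extT
    split_ifs with hc
    · omega
    · have := t1 i j ⟨by tauto, hb⟩
      omega
  · rintro i j1 j2 hj ⟨ha, hb⟩ ⟨hc, hd⟩
    unfold extT
    by_cases hm2 : (i, j2) ∈ μ
    · have hm1 : (i, j1) ∈ μ := μ.up_left_mem le_rfl hj hm2
      rw [if_neg (by tauto), if_neg (by tauto)]
      exact t2 i j1 j2 hj ⟨hm1, hb⟩ ⟨hm2, hd⟩
    · rw [if_pos (show (i, j2) ∈ lam ∧ (i, j2) ∉ μ from ⟨hc, hm2⟩)]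
      split_ifs with hq
      · exact le_rfl
      · have := t1 i j1 ⟨by tauto, hb⟩
        omega
  · rintro i1 i2 j hi ⟨ha, hb⟩ ⟨hc, hd⟩
    have hm1 : (i1, j) ∈ μ := h2 i1 j (lam.up_left_mem hi le_rfl hc)
    unfold extT
    rw [if_neg (show ¬ ((i1, j) ∈ lam ∧ (i1, j) ∉ μ) by tauto)]
    by_cases hm2 : (i2, j) ∈ μ
    · rw [if_neg (by tauto)]
      exact t3 i1 i2 j hi ⟨hm1, hb⟩ ⟨hm2, hd⟩
    · rw [if_pos ⟨hc, hm2⟩]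
      exact t1 i1 j ⟨hm1, hb⟩
  · intro i j hij
    unfold extT
    have hq := ht (i, j)
    have hq' := hm (i, j)
    rw [if_neg (by tauto)]
    exact t4 i j (by tauto)

theorem extT_lt {m : ℕ} {lam μ tau : YoungDiagram} (h1 : μ ≤ lam)
    {T : ℕ → ℕ → ℕ} (hT : IsSkewSSYT m μ tau T) (i j : ℕ) (hl : (i, j) ∈ lam) (ht : (i, j) ∉ tau) :
    extT m lam μ T i j < m ↔ (i, j) ∈ μ := by
  unfold extT
  constructor
  · intro h
    by_contra hn
    rw [if_pos ⟨hl, hn⟩] at h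
    omega
  · intro h
    rw [if_neg (by tauto)]
    exact hT.1 i j (by simp [h, ht])

theorem exists_restrict {m : ℕ} {lam tau : YoungDiagram} (h : tau ≤ lam) {T : ℕ → ℕ → ℕ}
    (hT : IsSkewSSYT (m+1) lam tau T) : ∃ μ, μ ≤ lam ∧ HS lam μ ∧ tau ≤ μ ∧ ∃ T',
      IsSkewSSYT m μ tau T' ∧ extT m lam μ T' = T := by
  classical
  have htl : ∀ c, c ∈ tau → c ∈ lam := fun c hc => h hc
  obtain ⟨t1, t2, t3, t4⟩ := hT
  simp only [mem_sdiff, YoungDiagram.mem_cells] at t1 t2 t3 t4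
  have hlow : IsLowerSet ((lam.cells.filter fun c => c ∈ tau ∨ T c.1 c.2 < m : Finset (ℕ × ℕ)) :
      Set (ℕ × ℕ)) := by
    rintro ⟨i, j⟩ ⟨i', j'⟩ hle hc
    simp only [Prod.mk_le_mk] at hle
    simp only [mem_coe, mem_filter, YoungDiagram.mem_cells] at hc ⊢
    have hl' : (i', j') ∈ lam := lam.up_left_mem hle.1 hle.2 hc.1
    refine ⟨hl', ?_⟩
    by_cases ht : (i, j) ∈ tau
    · exact Or.inl (tau.up_left_mem hle.1 hle.2 ht)
    · by_cases ht' : (i', j') ∈ tau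
      · exact Or.inl ht'
      · right
        have hlt : T i j < m := by tauto
        have hmid : (i', j) ∈ lam := lam.up_left_mem hle.1 le_rfl hc.1
        have hmid' : (i', j) ∉ tau := fun h => ht' (tau.up_left_mem le_rfl hle.2 h)
        have e1 := t2 i' j' j hle.2 ⟨hl', ht'⟩ ⟨hmid, hmid'⟩
        have e2 : T i' j ≤ T i j := by
          rcases hle.1.eq_or_lt with he | hlt
          · rw [he]
          · exact (t3 i' i j hlt ⟨hmid, hmid'⟩ ⟨hc.1, ht⟩).le
        omega
  let μ : YoungDiagram := ⟨_, hlow⟩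
  have hμ : ∀ c, c ∈ μ ↔ c ∈ lam ∧ (c ∈ tau ∨ T c.1 c.2 < m) := by
    intro c
    simp only [μ]
    rw [YoungDiagram.mem_mk, mem_filter, YoungDiagram.mem_cells]
  refine ⟨μ, fun c hc => ((hμ c).1 hc).1, ?_, fun c hc => (hμ c).2 ⟨htl c hc, Or.inl hc⟩,
    fun i j => if (i, j) ∈ μ then T i j else 0, ⟨?_, ?_, ?_, ?_⟩, ?_⟩
  · intro i j hij
    rw [hμ]
    have h1 : (i, j) ∈ lam := lam.up_left_mem (Nat.le_succ i) le_rfl hij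
    refine ⟨h1, ?_⟩
    by_cases ht : (i, j) ∈ tau
    · exact Or.inl ht
    · right
      have h2 : (i+1, j) ∉ tau := fun h => ht (tau.up_left_mem (Nat.le_succ i) le_rfl h)
      have e1 := t3 i (i+1) j (Nat.lt_succ_self i) ⟨h1, ht⟩ ⟨hij, h2⟩
      have e2 := t1 (i+1) j ⟨hij, h2⟩
      simp only
      omega
  all_goals try simp only [mem_sdiff, YoungDiagram.mem_cells]
  · rintro i j ⟨ha, hb⟩
    rw [if_pos ha]
    have := (hμ _).1 ha
    tauto
  · rintro i j1 j2 hj ⟨ha, hb⟩ ⟨hc, hd⟩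
    rw [if_pos ha, if_pos hc]
    exact t2 i j1 j2 hj ⟨((hμ _).1 ha).1, hb⟩ ⟨((hμ _).1 hc).1, hd⟩
  · rintro i1 i2 j hj ⟨ha, hb⟩ ⟨hc, hd⟩
    rw [if_pos ha, if_pos hc]
    exact t3 i1 i2 j hj ⟨((hμ _).1 ha).1, hb⟩ ⟨((hμ _).1 hc).1, hd⟩
  · intro i j hij
    split_ifs with hc
    · apply t4
      tauto
    · rfl
  · funext i j
    unfold extT
    have hh := hμ (i, j)
    simp only at hh
    beta_reduce
    split_ifs with h1 h2
    · have := t1 i j ⟨h1.1, by tauto⟩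
      have : ¬ T i j < m := by tauto
      omega
    · rfl
    · symm
      apply t4
      tauto

open Classical in
theorem skewS_succ {R : Type*} [CommRing R] (m : ℕ) (x : ℕ → R) (lam tau : YoungDiagram)
    (h : tau ≤ lam) :
    skewS (m+1) x lam tau = ∑ μ ∈ (below lam).filter (HS lam),
      if tau ≤ μ then x m ^ (lam.card - μ.card) * skewS m x μ tau else 0 := by
  rw [← Finset.sum_filter]
  unfold skewS
  simp only [Finset.mul_sum]
  rw [Finset.sum_sigma']
  symm
  refine Finset.sum_bij (fun q _ => extT m lam q.1 q.2) ?_ ?_ ?_ ?_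
  · rintro ⟨μ, T⟩ hq
    simp only [mem_sigma, mem_filter, mem_below, mem_tabs] at hq
    rw [mem_tabs]
    exact extT_ssyt hq.1.1.1 hq.1.1.2 hq.1.2 hq.2
  · rintro ⟨μ, T⟩ hq ⟨μ', T'⟩ hq' he
    simp only [mem_sigma, mem_filter, mem_below, mem_tabs] at hq hq'
    simp only at he
    have hμ : μ = μ' := by
      apply SetLike.ext
      rintro ⟨i, j⟩
      have a1 : (i, j) ∈ μ → (i, j) ∈ lam := fun hc => hq.1.1.1 hc
      have a2 : (i, j) ∈ μ' → (i, j) ∈ lam := fun hc => hq'.1.1.1 hc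
      have a3 : (i, j) ∈ tau → (i, j) ∈ μ := fun hc => hq.1.2 hc
      have a4 : (i, j) ∈ tau → (i, j) ∈ μ' := fun hc => hq'.1.2 hc
      by_cases hl : (i, j) ∈ lam
      · by_cases ht : (i, j) ∈ tau
        · tauto
        · rw [← extT_lt hq.1.1.1 hq.2 i j hl ht, ← extT_lt hq'.1.1.1 hq'.2 i j hl ht, he]
      · tauto
    subst hμ
    have hT : T = T' := by
      funext i j
      by_cases hc : (i, j) ∈ lam ∧ (i, j) ∉ μ
      · rw [hq.2.2.2.2 i j (by simp [hc.2]), hq'.2.2.2.2 i j (by simp [hc.2])]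
      · have := congrFun (congrFun he i) j
        unfold extT at this
        rwa [if_neg hc, if_neg hc] at this
    rw [hT]
  · intro T hT
    rw [mem_tabs] at hT
    obtain ⟨μ, h1, h2, h3, T', h4, h5⟩ := exists_restrict h hT
    refine ⟨⟨μ, T'⟩, ?_, h5⟩
    simp only [mem_sigma, mem_filter, mem_below, mem_tabs]
    exact ⟨⟨⟨h1, h2⟩, h3⟩, h4⟩
  · rintro ⟨μ, T⟩ hq
    simp only [mem_sigma, mem_filter, mem_below, mem_tabs] at hq
    have c1 : μ.cells ⊆ lam.cells := YoungDiagram.cells_subset_iff.2 hq.1.1.1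
    have c2 : tau.cells ⊆ μ.cells := YoungDiagram.cells_subset_iff.2 hq.1.2
    have hun : lam.cells \ tau.cells = (lam.cells \ μ.cells) ∪ (μ.cells \ tau.cells) := by
      ext c
      have := @c1 c
      have := @c2 c
      simp only [mem_sdiff, mem_union]
      tauto
    rw [hun, Finset.prod_union]
    · congr 1
      · rw [Finset.prod_congr rfl (g := fun _ => x m), Finset.prod_const, Finset.card_sdiff_of_subset c1]
        rintro ⟨i, j⟩ hc
        simp only [mem_sdiff, YoungDiagram.mem_cells] at hc
        unfold extT
        rw [if_pos hc]
      · refine Finset.prod_congr rfl ?_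
        rintro ⟨i, j⟩ hc
        simp only [mem_sdiff, YoungDiagram.mem_cells] at hc
        unfold extT
        rw [if_neg (by tauto)]
    · rw [Finset.disjoint_left]
      intro c hc hc'
      simp only [mem_sdiff] at hc hc'
      exact hc.2 hc'.1

theorem Rows_bot (M : ℕ) : Rows M ⊥ := by
  intro i _
  by_contra hne
  have h1 : (i, 0) ∈ (⊥ : YoungDiagram) := YoungDiagram.mem_iff_lt_rowLen.2 (Nat.pos_of_ne_zero hne)
  simp at h1

theorem jt_one {R : Type*} [CommRing R] (M : ℕ) (lam : YoungDiagram) [Decidable (⊥ = lam)] :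
    jt (1 : PowerSeries R) (lv (M+1) lam) = if ⊥ = lam then 1 else 0 := by
  split_ifs with h
  · have : lv (M+1) lam = fun a : Fin (M+1) => (a:ℕ) := by
      funext a
      unfold lv
      rw [← h, Rows_bot 0 _ (Nat.zero_le _), zero_add]
    rw [this, jt_id _ (by simp)]
  · unfold jt
    apply Matrix.det_eq_zero_of_row_eq_zero (Fin.last M)
    intro r
    rw [Matrix.of_apply, mul_one, PowerSeries.coeff_X_pow, if_neg]
    have : 0 < lam.rowLen 0 := by
      by_contra h0
      apply h
      apply YD_ext
      intro i
      rw [Rows_bot 0 _ (Nat.zero_le _)]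
      have := lam.rowLen_anti 0 i (Nat.zero_le _)
      omega
    unfold lv
    have hr := r.2
    simp
    omega

theorem card_transpose (μ : YoungDiagram) : μ.transpose.card = μ.card := by
  unfold YoungDiagram.card
  refine Finset.card_bij (fun c _ => c.swap) ?_ ?_ ?_
  · intro c hc
    simpa using hc
  · intro a _ b _ h
    exact Prod.swap_injective h
  · intro c hc
    exact ⟨c.swap, by simpa using hc, by simp⟩

theorem skewS_y {R : Type*} [CommRing R] (M : ℕ) (y : ℕ → R) (n : ℕ) :
    ∀ tau, Rows (M+1) tau → skewS n y tau.transpose ⊥ =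
      jt (∏ j ∈ range n, (1 + PowerSeries.C (y j) * PowerSeries.X)) (lv (M+1) tau) := by
  classical
  induction n with
  | zero =>
    intro tau _
    rw [prod_range_zero, jt_one, skewS_zero _ _ _ bot_le]
    have : ((⊥ : YoungDiagram) = tau.transpose) ↔ (⊥ = tau) := by
      constructor
      · intro h
        apply le_antisymm bot_le
        rintro ⟨i, j⟩ hc
        have h1 : (j, i) ∈ tau.transpose := by rw [YoungDiagram.mem_transpose]; exact hc
        rw [← h] at h1
        simp at h1
      · rintro rfl
        apply le_antisymm bot_le
        rintro ⟨i, j⟩ hc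
        have h1 : (i, j) ∈ (⊥ : YoungDiagram).transpose := hc
        rw [YoungDiagram.mem_transpose] at h1
        simp at h1
    simp only [this]
  | succ n ih =>
    intro tau ht
    rw [skewS_succ _ _ _ _ bot_le, prod_range_succ, branch_V _ _ (y n) rfl tau ht]
    symm
    refine Finset.sum_bij (fun μ _ => μ.transpose) ?_ ?_ ?_ ?_
    · intro μ hμ
      rw [mem_filter, mem_below] at hμ ⊢
      exact ⟨YoungDiagram.transpose_mono hμ.1, VS_transpose.2 hμ.2⟩
    · intro μ _ ν _ h
      exact YoungDiagram.transpose_eq_iff.1 h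
    · intro μ hμ
      refine ⟨μ.transpose, ?_, by simp⟩
      rw [mem_filter, mem_below] at hμ ⊢
      refine ⟨?_, ?_⟩
      · rw [← YoungDiagram.transpose_le_iff]; simpa using hμ.1
      · rw [← VS_transpose]; simpa using hμ.2
    · intro μ hμ
      rw [mem_filter, mem_below] at hμ
      rw [if_pos bot_le, ih μ (ht.mono hμ.1), card_transpose, card_transpose]

theorem skewS_x {R : Type*} [CommRing R] (M : ℕ) (x : ℕ → R) (g : PowerSeries R) (m : ℕ) :
    ∀ h : PowerSeries R, h * ∏ i ∈ range m, (1 - PowerSeries.C (x i) * PowerSeries.X) = g →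
    ∀ lam, Rows (M+1) lam → ∑ tau ∈ below lam, skewS m x lam tau * jt g (lv (M+1) tau) =
      jt h (lv (M+1) lam) := by
  classical
  induction m with
  | zero =>
    intro h hh lam _
    rw [prod_range_zero, mul_one] at hh
    subst hh
    rw [Finset.sum_eq_single lam]
    · rw [skewS_zero _ _ _ le_rfl, if_pos rfl, one_mul]
    · intro tau ht hne
      rw [mem_below] at ht
      rw [skewS_zero _ _ _ ht, if_neg hne, zero_mul]
    · intro hn
      simp at hn
  | succ m ih =>
    intro h hh lam hl
    rw [prod_range_succ] at hh
    have ih' := ih (h * (1 - PowerSeries.C (x m) * PowerSeries.X)) (by rw [← hh]; ring)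
    rw [branch_H _ h (x m) rfl lam hl]
    have e1 : ∀ tau ∈ below lam, skewS (m+1) x lam tau * jt g (lv (M+1) tau) =
        ∑ μ ∈ (below lam).filter (HS lam), if tau ≤ μ then x m ^ (lam.card - μ.card) *
          (skewS m x μ tau * jt g (lv (M+1) tau)) else 0 := by
      intro tau ht
      rw [mem_below] at ht
      rw [skewS_succ _ _ _ _ ht, Finset.sum_mul]
      refine Finset.sum_congr rfl fun μ _ => ?_
      split_ifs
      · ring
      · ring
    rw [Finset.sum_congr rfl e1, Finset.sum_comm]
    refine Finset.sum_congr rfl fun μ hμ => ?_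
    rw [mem_filter, mem_below] at hμ
    rw [← ih' μ (hl.mono hμ.1), Finset.mul_sum, ← Finset.sum_filter]
    refine Finset.sum_congr ?_ fun _ _ => rfl
    ext tau
    simp only [mem_filter, mem_below]
    exact ⟨fun h => h.2, fun h => ⟨h.trans hμ.1, h⟩⟩

end CF


namespace CF
open Finset

noncomputable def xv (m n : ℕ) (i : ℕ) : MvPolynomial (Fin m ⊕ Fin n) ℚ :=
  if h : i < m then MvPolynomial.X (Sum.inl ⟨i, h⟩) else 0

noncomputable def yv (m n : ℕ) (i : ℕ) : MvPolynomial (Fin m ⊕ Fin n) ℚ :=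
  if h : i < n then MvPolynomial.X (Sum.inr ⟨i, h⟩) else 0

theorem prod_content {R : Type*} [CommRing R] (x : ℕ → R) (m : ℕ) (D : Finset (ℕ × ℕ))
    (T : ℕ → ℕ → ℕ) (hT : ∀ c ∈ D, T c.1 c.2 < m) :
    ∏ c ∈ D, x (T c.1 c.2) = ∏ k : Fin m, x k ^ (D.filter fun c => T c.1 c.2 = k.val).card := by
  rw [Finset.prod_fin_eq_prod_range]
  rw [← Finset.prod_fiberwise_of_maps_to (t := range m) (g := fun c : ℕ × ℕ => T c.1 c.2)
    (fun c hc => mem_range.2 (hT c hc))]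
  refine Finset.prod_congr rfl fun k hk => ?_
  rw [dif_pos (mem_range.1 hk)]
  rw [Finset.prod_congr rfl (g := fun _ => x k), Finset.prod_const]
  intro c hc
  rw [(mem_filter.1 hc).2]

theorem monomial_content {m n : ℕ} (a : Fin m → ℕ) (b : Fin n → ℕ) :
    (∏ k : Fin m, xv m n k ^ a k) * (∏ k : Fin n, yv m n k ^ b k) =
      MvPolynomial.monomial (Finsupp.equivFunOnFinite.symm (Sum.elim a b)) 1 := by
  rw [MvPolynomial.monomial_eq, Finsupp.prod_fintype _ _ (by simp), Fintype.prod_sum_type]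
  simp [xv, yv]

open Classical in
theorem coeff_super {m n : ℕ} (lam : YoungDiagram) (e : Fin m ⊕ Fin n →₀ ℕ) :
    (superSchurCoeff m n lam e : ℚ) = MvPolynomial.coeff e
      (∑ tau ∈ below lam, skewS m (xv m n) lam tau * skewS n (yv m n) tau.transpose ⊥) := by
  let F : Finset (Σ _ : YoungDiagram, (ℕ → ℕ → ℕ) × (ℕ → ℕ → ℕ)) :=
    (below lam).sigma (fun tau => tabs m lam tau ×ˢ tabs n tau.transpose ⊥)
  let P : (Σ _ : YoungDiagram, (ℕ → ℕ → ℕ) × (ℕ → ℕ → ℕ)) → Prop := fun t =>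
    (∀ k : Fin m, e (Sum.inl k)
        = ((lam.cells \ t.1.cells).filter fun c => t.2.1 c.1 c.2 = k.val).card) ∧
    (∀ k : Fin n, e (Sum.inr k)
        = ((t.1.transpose.cells \ (⊥ : YoungDiagram).cells).filter
            fun c => t.2.2 c.1 c.2 = k.val).card)
  have h1 : superSchurCoeff m n lam e = (F.filter P).card := by
    unfold superSchurCoeff
    rw [← Set.ncard_coe_finset, ← Set.ncard_image_of_injective (↑(F.filter P))
      (f := fun q : (Σ _ : YoungDiagram, (ℕ → ℕ → ℕ) × (ℕ → ℕ → ℕ)) =>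
        ((q.1, q.2) : YoungDiagram × (ℕ → ℕ → ℕ) × (ℕ → ℕ → ℕ)))]
    · congr 1
      ext ⟨t, T, T'⟩
      simp only [Set.mem_image, coe_filter, F, P]
      constructor
      · rintro ⟨a1, a2, a3, a4, a5⟩
        refine ⟨⟨t, T, T'⟩, ?_, rfl⟩
        refine ⟨?_, a4, a5⟩
        simp [a1, a2, a3]
      · rintro ⟨⟨t, T, T'⟩, ⟨b1, b2, b3⟩, hq⟩
        simp only [Prod.mk.injEq] at hq
        obtain ⟨rfl, rfl, rfl⟩ := hq
        simp only [mem_sigma, mem_below, mem_product, mem_tabs] at b1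
        exact ⟨b1.1, b1.2.1, b1.2.2, b2, b3⟩
    · rintro ⟨t, T⟩ ⟨t', T'⟩ h
      simp only [Prod.mk.injEq] at h
      obtain ⟨rfl, rfl⟩ := h
      rfl
  rw [h1, Finset.card_filter, Nat.cast_sum, Finset.sum_sigma, MvPolynomial.coeff_sum]
  refine Finset.sum_congr rfl fun tau _ => ?_
  unfold skewS
  rw [Finset.sum_mul_sum, ← Finset.sum_product', MvPolynomial.coeff_sum]
  refine Finset.sum_congr rfl ?_
  rintro ⟨T, T'⟩ hT
  simp only [mem_product, mem_tabs] at hT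
  rw [prod_content _ m _ T (fun c hc => hT.1.1 _ _ hc), prod_content _ n _ T' (fun c hc => hT.2.1 _ _ hc),
    monomial_content, MvPolynomial.coeff_monomial]
  push_cast
  refine if_congr ?_ rfl rfl
  constructor
  · rintro ⟨h1, h2⟩
    ext s
    rcases s with k | k
    · simp [h1]
    · simp [h2]
  · rintro h
    refine ⟨fun k => ?_, fun k => ?_⟩
    · rw [← h]; simp
    · rw [← h]; simp

theorem coeff_jt {m n : ℕ} (M : ℕ) (h : PowerSeries (MvPolynomial (Fin m ⊕ Fin n) ℚ))
    (hh : h * ∏ i, (1 - PowerSeries.C (MvPolynomial.X (Sum.inl i)) * PowerSeries.X) =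
      ∏ j, (1 + PowerSeries.C (MvPolynomial.X (Sum.inr j)) * PowerSeries.X))
    (lam : YoungDiagram) (hl : Rows (M+1) lam) (e : Fin m ⊕ Fin n →₀ ℕ) :
    MvPolynomial.coeff e (jt h (lv (M+1) lam)) = (superSchurCoeff m n lam e : ℚ) := by
  rw [coeff_super]
  congr 1
  have h1 : h * ∏ i ∈ range m, (1 - PowerSeries.C (xv m n i) * PowerSeries.X) =
      ∏ j ∈ range n, (1 + PowerSeries.C (yv m n j) * PowerSeries.X) := by
    rw [Finset.prod_range, Finset.prod_range]
    simpa [xv, yv] using hh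
  rw [← skewS_x M (xv m n) _ m h h1 lam hl]
  refine Finset.sum_congr rfl fun tau ht => ?_
  rw [mem_below] at ht
  rw [skewS_y M (yv m n) n tau (hl.mono ht)]

theorem card_content (m : ℕ) (D : Finset (ℕ × ℕ))
    (T : ℕ → ℕ → ℕ) (hT : ∀ c ∈ D, T c.1 c.2 < m) :
    ∑ k : Fin m, (D.filter fun c => T c.1 c.2 = k.val).card = D.card := by
  rw [Finset.card_eq_sum_card_fiberwise (t := range m) (f := fun c : ℕ × ℕ => T c.1 c.2)
    (fun c hc => by simpa using hT c hc), Finset.sum_range]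

theorem superCoeff_card {m n : ℕ} {lam : YoungDiagram} {e : Fin m ⊕ Fin n →₀ ℕ}
    (h : superSchurCoeff m n lam e ≠ 0) : lam.card = e.degree := by
  obtain ⟨⟨t, T, T'⟩, a1, a2, a3, a4, a5⟩ := Set.nonempty_of_ncard_ne_zero h
  simp only at a1 a2 a3 a4 a5
  rw [Finsupp.degree_eq_sum, Fintype.sum_sum_type]
  simp only [a4, a5]
  rw [card_content m _ T (fun c hc => a2.1 _ _ hc), card_content n _ T' (fun c hc => a3.1 _ _ hc)]
  have c1 : t.cells ⊆ lam.cells := YoungDiagram.cells_subset_iff.2 a1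
  rw [Finset.card_sdiff_of_subset c1, YoungDiagram.cells_bot, sdiff_empty]
  have := card_transpose t
  unfold YoungDiagram.card at *
  rw [this]
  have := Finset.card_le_card c1
  omega

/-- strictly increasing sequence has at least its index as value -/
theorem no_long_col (m : ℕ) (f : ℕ → ℕ) (h1 : ∀ i ≤ m, f i < m)
    (h2 : ∀ i1 i2, i1 < i2 → i2 ≤ m → f i1 < f i2) : False := by
  have : ∀ i ≤ m, i ≤ f i := by
    intro i
    induction i with
    | zero => intro _; omega
    | succ i ih =>
      intro hi
      have := ih (by omega)
      have := h2 i (i+1) (by omega) hi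
      omega
  have a := this m le_rfl
  have b := h1 m le_rfl
  omega

theorem superCoeff_hook {m n : ℕ} {lam : YoungDiagram} {e : Fin m ⊕ Fin n →₀ ℕ}
    (h : superSchurCoeff m n lam e ≠ 0) : lam.rowLen m ≤ n := by
  obtain ⟨⟨t, T, T'⟩, a1, a2, a3, a4, a5⟩ := Set.nonempty_of_ncard_ne_zero h
  simp only at a1 a2 a3
  by_contra hlt
  have hmem : (m, n) ∈ lam := YoungDiagram.mem_iff_lt_rowLen.2 (not_le.1 hlt)
  by_cases h0 : (0, n) ∈ t
  · have hin : ∀ i ≤ n, (i, 0) ∈ t.transpose.cells \ (⊥ : YoungDiagram).cells := by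
      intro i hi
      simp only [YoungDiagram.cells_bot, sdiff_empty, YoungDiagram.mem_cells, YoungDiagram.mem_transpose]
      exact t.up_left_mem le_rfl hi h0
    exact no_long_col n (fun i => T' i 0) (fun i hi => a3.1 i 0 (hin i hi))
      (fun i1 i2 h12 hi => a3.2.2.1 i1 i2 0 h12 (hin i1 (by omega)) (hin i2 hi))
  · have hin : ∀ i ≤ m, (i, n) ∈ lam.cells \ t.cells := by
      intro i hi
      simp only [mem_sdiff, YoungDiagram.mem_cells]
      exact ⟨lam.up_left_mem hi le_rfl hmem, fun hc => h0 (t.up_left_mem (Nat.zero_le _) le_rfl hc)⟩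
    exact no_long_col m (fun i => T i n) (fun i hi => a2.1 i n (hin i hi))
      (fun i1 i2 h12 hi => a2.2.2.1 i1 i2 n h12 (hin i1 (by omega)) (hin i2 hi))

end CF


namespace CF
open Finset

theorem mem_diag_iff (lam : YoungDiagram) (k : ℕ) : k < frobRank lam ↔ k < lam.rowLen k := by
  have hcard : frobRank lam = ((range lam.card).filter fun k => k < lam.rowLen k).card := by
    unfold frobRank
    refine Finset.card_bij (fun c _ => c.1) ?_ ?_ ?_
    · rintro ⟨i, j⟩ h
      simp only [mem_filter, YoungDiagram.mem_cells] at h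
      obtain ⟨h1, h2⟩ := h
      simp only [mem_filter, mem_range]
      subst h2
      refine ⟨?_, YoungDiagram.mem_iff_lt_rowLen.1 h1⟩
      have : ((range (i+1)).image fun a => (a, i)) ⊆ lam.cells := by
        intro c hc
        simp only [mem_image, mem_range] at hc
        obtain ⟨a, ha, rfl⟩ := hc
        exact lam.up_left_mem (by omega) le_rfl h1
      have h3 := Finset.card_le_card this
      rw [Finset.card_image_of_injective _ (fun a b h => by simpa using h)] at h3
      rw [card_range] at h3
      exact h3
    · rintro ⟨i, j⟩ h ⟨i', j'⟩ h' hh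
      simp only [mem_filter] at h h' hh
      obtain ⟨_, rfl⟩ := h
      obtain ⟨_, rfl⟩ := h'
      simp [hh]
    · intro k hk
      simp only [mem_filter] at hk
      exact ⟨(k, k), by simpa using YoungDiagram.mem_iff_lt_rowLen.2 hk.2, rfl⟩
  have hlow : ∀ a b, a ≤ b → b < lam.rowLen b → a < lam.rowLen a := by
    intro a b hab h
    have := lam.rowLen_anti a b hab
    omega
  have hbig : ∀ k, k < lam.rowLen k → k < lam.card := by
    intro i h1
    have : ((range (i+1)).image fun a => (a, i)) ⊆ lam.cells := by
      intro c hc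
      simp only [mem_image, mem_range] at hc
      obtain ⟨a, ha, rfl⟩ := hc
      exact lam.up_left_mem (by omega) le_rfl (YoungDiagram.mem_iff_lt_rowLen.2 h1)
    have h3 := Finset.card_le_card this
    rw [Finset.card_image_of_injective _ (fun a b h => by simpa using h)] at h3
    rw [card_range] at h3
    exact h3
  rw [hcard]
  constructor
  · intro h
    by_contra hk
    have hsub : ((range lam.card).filter fun k => k < lam.rowLen k) ⊆ range k := by
      intro a ha
      simp only [mem_filter, mem_range] at ha ⊢
      by_contra hc
      exact hk (hlow k a (by omega) ha.2)
    have := Finset.card_le_card hsub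
    rw [card_range] at this
    omega
  · intro h
    have hsub : range (k+1) ⊆ ((range lam.card).filter fun k => k < lam.rowLen k) := by
      intro a ha
      simp only [mem_filter, mem_range] at ha ⊢
      have := hlow a k (by omega) h
      exact ⟨hbig a this, this⟩
    have := Finset.card_le_card hsub
    rw [card_range] at this
    omega

theorem mem_frobSet (p : ℕ) (lam : YoungDiagram) :
    lam ∈ frobSet p ↔ ∀ k, k < lam.rowLen k → lam.rowLen k = lam.colLen k + p := by
  simp only [frobSet, Set.mem_ofPred_eq, mem_diag_iff]

theorem lt_colLen_iff (lam : YoungDiagram) (i j : ℕ) : i < lam.colLen j ↔ j < lam.rowLen i := by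
  rw [← YoungDiagram.mem_iff_lt_colLen, YoungDiagram.mem_iff_lt_rowLen]

theorem colLen_eq (lam : YoungDiagram) (j c : ℕ) (h : ∀ i, j < lam.rowLen i ↔ i < c) :
    lam.colLen j = c := by
  apply eq_of_forall_lt_iff
  intro i
  rw [lt_colLen_iff, h]

/-- `σ` is obtained from `τ` by adding a first column of length `N+1` and a first row of
length `p + N + 1`. -/
structure Step (p N : ℕ) (τ σ : YoungDiagram) : Prop where
  r0 : σ.rowLen 0 = p + N + 1
  rs : ∀ k < N, σ.rowLen (k+1) = τ.rowLen k + 1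
  rσ : Rows (N+1) σ
  rτ : Rows N τ

theorem Step.frobRank {p N : ℕ} {τ σ : YoungDiagram} (h : Step p N τ σ) :
    frobRank σ = frobRank τ + 1 := by
  apply eq_of_forall_lt_iff
  intro k
  rw [mem_diag_iff]
  cases k with
  | zero => simp [h.r0]
  | succ k =>
    rw [Nat.add_lt_add_iff_right, mem_diag_iff]
    by_cases hk : k < N
    · rw [h.rs k hk]; omega
    · rw [h.rσ (k+1) (by omega), h.rτ k (by omega)]; omega

theorem Step.card {p N : ℕ} {τ σ : YoungDiagram} (h : Step p N τ σ) :
    σ.card = τ.card + (p + 2 * N + 1) := by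
  rw [card_eq_rows h.rσ, card_eq_rows h.rτ, Fin.sum_univ_succ]
  have : ∀ i : Fin N, σ.rowLen ((i.succ : Fin (N+1)) : ℕ) = τ.rowLen i + 1 := by
    intro i
    rw [Fin.val_succ, h.rs i i.2]
  simp only [this, Finset.sum_add_distrib]
  have := h.r0
  simp [this]
  omega

theorem Step.frobSet {p N : ℕ} {τ σ : YoungDiagram} (h : Step p N τ σ) :
    σ ∈ frobSet p ↔ τ ∈ frobSet p := by
  rw [mem_frobSet, mem_frobSet]
  have h0 : σ.colLen 0 = N + 1 := by
    apply colLen_eq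
    intro i
    cases i with
    | zero => simp [h.r0]
    | succ k =>
      by_cases hk : k < N
      · rw [h.rs k hk]; omega
      · rw [h.rσ (k+1) (by omega)]; omega
  have hs : ∀ k < N, σ.colLen (k+1) = τ.colLen k + 1 := by
    intro j hj
    apply colLen_eq
    intro i
    cases i with
    | zero => rw [h.r0]; omega
    | succ k =>
      rw [Nat.add_lt_add_iff_right, lt_colLen_iff]
      by_cases hk : k < N
      · rw [h.rs k hk]; omega
      · rw [h.rσ (k+1) (by omega), h.rτ k (by omega)]; omega
  constructor
  · intro H k hk
    have hkN : k < N := by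
      by_contra hc
      rw [h.rτ k (by omega)] at hk
      omega
    have := H (k+1) (by rw [h.rs k hkN]; omega)
    rw [h.rs k hkN, hs k hkN] at this
    omega
  · intro H k hk
    cases k with
    | zero => rw [h.r0, h0]; omega
    | succ k =>
      have hkN : k < N := by
        by_contra hc
        rw [h.rσ (k+1) (by omega)] at hk
        omega
      rw [h.rs k hkN] at hk ⊢
      rw [hs k hkN, H k (by omega)]
      omega

def LJ (p N : ℕ) (J : Finset (Fin N)) (i : Fin N) : ℕ :=
  if i ∈ J then p + N + (Fin.rev i : ℕ) else i

def ee (p : ℕ) (σ : YoungDiagram) : ℕ := (σ.cells.card - frobRank σ * (p-1))/2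

structure QFrob (p N : ℕ) (J : Finset (Fin N)) (σ : YoungDiagram) : Prop where
  rows : Rows N σ
  frob : σ ∈ frobSet p
  ineq : frobRank σ * (p-1) ≤ σ.cells.card
  perm : ∃ π : Equiv.Perm (Fin N), LJ p N J ∘ π = lv N σ ∧
    (Equiv.Perm.sign π : ℤ) * (-1) ^ J.card = (-1) ^ ee p σ

theorem LJ_succ (p N : ℕ) (J : Finset (Fin N)) (J' : Finset (Fin (N+1)))
    (hJ : ∀ i, i.succ ∈ J' ↔ i ∈ J) (i : Fin N) : LJ p (N+1) J' i.succ = LJ p N J i + 1 := by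
  unfold LJ
  simp only [hJ, Fin.rev_succ, Fin.val_castSucc, Fin.val_succ]
  split_ifs <;> omega

theorem QFrob.step0 {p N : ℕ} {J : Finset (Fin N)} {σ : YoungDiagram} (h : QFrob p N J σ) :
    QFrob p (N+1) (J.map (Fin.succEmb N)) σ := by
  obtain ⟨hr, hf, hi, π, hπ, hs⟩ := h
  refine ⟨fun i hi => hr i (by omega), hf, hi, Equiv.Perm.decomposeFin.symm (0, π), ?_, ?_⟩
  · funext i
    refine Fin.cases ?_ (fun i => ?_) i
    · have := hr N le_rfl
      simp [LJ, lv, this]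
    · simp only [Function.comp_apply, Equiv.Perm.decomposeFin_symm_apply_succ, Equiv.swap_self,
        Equiv.refl_apply]
      rw [LJ_succ p N J _ (by simp)]
      have := congrFun hπ i
      simp only [Function.comp_apply] at this
      rw [this]
      simp [lv, Fin.rev_succ]
      omega
  · rw [card_map, ← hs]
    simp

theorem QFrob.step1 {p N : ℕ} (hp : 0 < p) {J : Finset (Fin N)} {τ σ : YoungDiagram} (h : QFrob p N J τ)
    (hst : Step p N τ σ) : QFrob p (N+1) (insert 0 (J.map (Fin.succEmb N))) σ := by
  obtain ⟨hr, hf, hi, π, hπ, hs⟩ := h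
  have hc := hst.card
  have hrk := hst.frobRank
  unfold YoungDiagram.card at hc
  obtain ⟨q, rfl⟩ : ∃ q, p = q + 1 := ⟨p-1, by omega⟩
  refine ⟨hst.rσ, hst.frobSet.2 hf, ?_,
    finRotate (N+1) |>.trans (Equiv.Perm.decomposeFin.symm (0, π)), ?_, ?_⟩
  · rw [hc, hrk]
    simp only [Nat.add_sub_cancel] at hi ⊢
    rw [add_mul]; omega
  · funext i
    refine Fin.lastCases ?_ (fun i => ?_) i
    · simp [LJ, lv, hst.r0]
      omega
    · simp only [Function.comp_apply, Equiv.trans_apply]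
      have h1 : finRotate (N+1) i.castSucc = i.succ := by
        rw [finRotate_apply, Fin.coeSucc_eq_succ]
      rw [h1, Equiv.Perm.decomposeFin_symm_apply_succ]
      simp only [Equiv.swap_self, Equiv.refl_apply]
      rw [LJ_succ _ N J _ (by simp [Fin.succ_ne_zero])]
      have := congrFun hπ i
      simp only [Function.comp_apply] at this
      rw [this]
      simp only [lv, Fin.rev_castSucc, Fin.val_succ, Fin.val_castSucc]
      rw [hst.rs _ (Fin.rev i).2]
      omega
  · have he : ee (q+1) σ = ee (q+1) τ + (N+1) := by
      unfold ee
      rw [hc, hrk]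
      simp only [Nat.add_sub_cancel] at hi ⊢
      rw [add_mul]
      omega
    rw [card_insert_of_notMem (by simp), card_map, he, pow_add _ (ee _ _), ← hs, Equiv.Perm.sign_trans,
      sign_finRotate]
    simp
    ring

theorem rowLen0_le {p N : ℕ} {τ : YoungDiagram} (hr : Rows N τ) (hf : τ ∈ frobSet p) :
    τ.rowLen 0 ≤ p + N := by
  by_cases h0 : 0 < τ.rowLen 0
  · rw [(mem_frobSet p τ).1 hf 0 h0]
    have : ¬ N < τ.colLen 0 := by
      rw [lt_colLen_iff, hr N le_rfl]; omega
    omega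
  · omega

theorem exists_QFrob {p : ℕ} (hp : 0 < p) (N : ℕ) :
    (∀ J, ∃ σ, QFrob p N J σ) ∧ (∀ σ, Rows N σ → σ ∈ frobSet p → ∃ J, QFrob p N J σ) := by
  induction N with
  | zero =>
    have key : QFrob p 0 ∅ ⊥ := by
      refine ⟨Rows_bot _, ?_, ?_, 1, ?_, ?_⟩
      · rw [mem_frobSet]
        intro k hk
        rw [Rows_bot 0 k (Nat.zero_le _)] at hk
        omega
      · simp [frobRank]
      · funext i; exact i.elim0
      · simp [ee]
    refine ⟨fun J => ⟨⊥, ?_⟩, fun σ hσ _ => ⟨∅, ?_⟩⟩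
    · rw [Subsingleton.elim J ∅]; exact key
    · have : σ = ⊥ := YD_ext fun i => by rw [hσ i (Nat.zero_le _), Rows_bot 0 i (Nat.zero_le _)]
      rw [this]; exact key
  | succ N ih =>
    constructor
    · intro J
      set J' : Finset (Fin N) := univ.filter fun i => i.succ ∈ J with hJ'
      obtain ⟨τ, hτ⟩ := ih.1 J'
      by_cases h0 : (0 : Fin (N+1)) ∈ J
      · have hJ : J = insert 0 (J'.map (Fin.succEmb N)) := by
          ext i
          refine Fin.cases ?_ (fun i => ?_) i
          · simp [h0]
          · simp [hJ', Fin.succ_ne_zero]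
        obtain ⟨σ, hσ⟩ := exists_YD (fun k => if k = 0 then p + N + 1 else
          if k ≤ N then τ.rowLen (k-1) + 1 else 0) (by
            apply antitone_nat_of_succ_le
            intro k
            have h1 := rowLen0_le hτ.rows hτ.frob
            have h2 := τ.rowLen_anti (k-1) k (by omega)
            rcases Nat.eq_zero_or_pos k with rfl | hk
            · simp; split_ifs <;> omega
            · simp; split_ifs <;> omega) (N+1) (by simp)
        refine ⟨σ, ?_⟩
        rw [hJ]
        refine hτ.step1 hp ⟨by simp [hσ], fun k hk => ?_, fun i hi => ?_, hτ.rows⟩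
        · rw [hσ]; simp; omega
        · rw [hσ, if_neg (by omega), if_neg (by omega)]
      · have hJ : J = J'.map (Fin.succEmb N) := by
          ext i
          refine Fin.cases ?_ (fun i => ?_) i
          · simp [h0]
          · simp [hJ']
        exact ⟨τ, hJ ▸ hτ.step0⟩
    · intro σ hr hf
      by_cases h0 : σ.rowLen N = 0
      · have hr' : Rows N σ := by
          intro i hi
          have := σ.rowLen_anti N i hi
          omega
        obtain ⟨J, hJ⟩ := ih.2 σ hr' hf
        exact ⟨_, hJ.step0⟩
      · obtain ⟨τ, hτ⟩ := exists_YD (fun k => σ.rowLen (k+1) - 1) (by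
            apply antitone_nat_of_succ_le
            intro k
            have h2 := σ.rowLen_anti (k+1) (k+1+1) (by omega)
            omega) N (by rw [hr (N+1) le_rfl])
        have hst : Step p N τ σ := by
          refine ⟨?_, ?_, hr, ?_⟩
          · have hpos := σ.rowLen_anti 0 N (by omega)
            rw [(mem_frobSet p σ).1 hf 0 (by omega)]
            have : σ.colLen 0 = N + 1 := by
              apply colLen_eq
              intro i
              constructor
              · intro hi
                by_contra hc
                rw [hr i (by omega)] at hi
                omega
              · intro hi
                have := σ.rowLen_anti i N (by omega)
                omega
            omega
          · intro k hk
            have := σ.rowLen_anti (k+1) N (by omega)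
            rw [hτ]; omega
          · intro i hi
            rw [hτ, hr (i+1) (by omega)]
        obtain ⟨J, hJ⟩ := ih.2 τ hst.rτ (hst.frobSet.1 hf)
        exact ⟨_, hJ.step1 hp hst⟩

theorem QFrob_inj_J {p N : ℕ} {J J' : Finset (Fin N)} {σ : YoungDiagram} (h : QFrob p N J σ)
    (h' : QFrob p N J' σ) : J = J' := by
  have key : ∀ {J : Finset (Fin N)}, QFrob p N J σ → ∀ i, i ∈ J ↔ ∀ j, lv N σ j ≠ i := by
    intro J h i
    obtain ⟨_, _, _, π, hπ, _⟩ := h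
    rw [← hπ]
    constructor
    · intro hi j hj
      simp only [Function.comp_apply, LJ] at hj
      split_ifs at hj with h1
      · have := i.2; omega
      · exact h1 (by rwa [Fin.ext hj])
    · intro H
      by_contra hi
      exact H (π.symm i) (by simp [LJ, hi])
  ext i
  rw [key h, key h']

theorem QFrob_inj_σ {p N : ℕ} {J : Finset (Fin N)} {σ σ' : YoungDiagram} (h : QFrob p N J σ)
    (h' : QFrob p N J σ') : σ = σ' := by
  obtain ⟨hr, _, _, π, hπ, _⟩ := h
  obtain ⟨hr', _, _, π', hπ', _⟩ := h'
  apply lv_inj hr hr'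
  apply (lv_strictMono N σ).range_inj (lv_strictMono N σ') |>.1
  rw [← hπ, ← hπ', Set.range_comp, Set.range_comp]
  simp

theorem jt_perm {R : Type*} [CommRing R] {M : ℕ} (h : PowerSeries R) (l : Fin M → ℕ)
    (π : Equiv.Perm (Fin M)) : jt h (l ∘ π) = ((Equiv.Perm.sign π : ℤ) : R) * jt h l := by
  unfold jt
  rw [← Matrix.det_permute]
  rfl

theorem GG_expand {R : Type*} [CommRing R] (p N : ℕ) (h : PowerSeries R) :
    GG (p+N) N h = ∑ J : Finset (Fin N), (-1) ^ J.card * jt h (LJ p N J) := by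
  have h1 : GG (p+N) N h = ((Matrix.of fun a r : Fin N => - PowerSeries.coeff (p + N + (Fin.rev a : ℕ)) (PowerSeries.X ^ (r:ℕ) * h)) + (Matrix.of fun a r : Fin N => PowerSeries.coeff (a:ℕ) (PowerSeries.X ^ (r:ℕ) * h))).det := by
    unfold GG
    congr 1
    ext a r
    simp
    ring
  rw [h1, det_add_rows]
  refine Finset.sum_congr rfl fun J _ => ?_
  unfold jt
  have h2 : ((-1:R)) ^ J.card = ∏ i : Fin N, if i ∈ J then (-1:R) else 1 := by
    rw [Finset.prod_ite_mem, univ_inter, Finset.prod_const]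
  rw [h2, ← Matrix.det_mul_column]
  congr 1
  ext a r
  simp only [pw, LJ, Matrix.of_apply]
  split_ifs <;> simp

theorem GG_eq {R : Type*} [CommRing R] (p N : ℕ) (hp : 0 < p) (h : PowerSeries R)
    (T : Finset YoungDiagram) (hT : ∀ σ, σ ∈ T ↔ Rows N σ ∧ σ ∈ frobSet p) :
    GG (p+N) N h = ∑ σ ∈ T, (-1) ^ ee p σ * jt h (lv N σ) := by
  rw [GG_expand]
  choose f hf using (exists_QFrob hp N).1
  refine Finset.sum_bij (fun J _ => f J) ?_ ?_ ?_ ?_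
  · intro J _
    exact (hT _).2 ⟨(hf J).rows, (hf J).frob⟩
  · intro J _ J' _ hh
    exact QFrob_inj_J (hf J) (hh ▸ hf J')
  · intro σ hσ
    obtain ⟨J, hJ⟩ := (exists_QFrob hp N).2 σ ((hT σ).1 hσ).1 ((hT σ).1 hσ).2
    exact ⟨J, mem_univ _, QFrob_inj_σ (hf J) hJ⟩
  · intro J _
    obtain ⟨_, _, _, π, hπ, hs⟩ := hf J
    rw [← hπ, jt_perm]
    have hs' := congrArg (Int.cast : ℤ → R) hs
    push_cast at hs'
    rw [← hs']
    have : ((Equiv.Perm.sign π : ℤ) : R) * ((Equiv.Perm.sign π : ℤ) : R) = 1 := by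
      rw [← Int.cast_mul]
      simp
    linear_combination (-(-1)^J.card * jt h (LJ p N J)) * this

theorem FF_eq {R : Type*} [CommRing R] (p N : ℕ) (h : PowerSeries R)
    (T : Finset YoungDiagram) (hT : ∀ σ, σ ∈ T ↔ Rows (N+1) σ ∧ σ.rowLen 0 ≤ p) :
    FF (p+(N+1)) (N+1) h = ∑ σ ∈ T, jt h (lv (N+1) σ) := by
  unfold FF
  symm
  have hb : ∀ σ ∈ T, ∀ a, lv (N+1) σ a < p + (N+1) := by
    intro σ hσ a
    have h1 := ((hT σ).1 hσ).2
    have h2 := σ.rowLen_anti 0 (Fin.rev a) (by omega)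
    unfold lv
    have := a.2
    omega
  refine Finset.sum_bij (fun σ hσ a => ⟨lv (N+1) σ a, hb σ hσ a⟩) ?_ ?_ ?_ ?_
  · intro σ hσ
    simp only [mem_filter, mem_univ, true_and]
    intro a b hab
    exact lv_strictMono (N+1) σ hab
  · intro σ hσ σ' hσ' hh
    apply lv_inj ((hT σ).1 hσ).1 ((hT σ').1 hσ').1
    funext a
    simpa using congrFun hh a
  · intro l hl
    simp only [mem_filter, mem_univ, true_and] at hl
    obtain ⟨σ, hr, hs⟩ := lv_surj (fun a => (l a : ℕ)) (fun a b hab => hl hab)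
    have hσ : σ ∈ T := by
      refine (hT σ).2 ⟨hr, ?_⟩
      have h1 := congrFun hs (Fin.last N)
      simp [lv] at h1
      have := (l (Fin.last N)).2
      omega
    refine ⟨σ, hσ, ?_⟩
    funext a
    exact Fin.ext (congrFun hs a)
  · intro σ hσ
    rfl

end CF


namespace CF
open Finset

theorem exists_h (m n : ℕ) : ∃ h : PowerSeries (MvPolynomial (Fin m ⊕ Fin n) ℚ),
    h * ∏ i : Fin m, (1 - PowerSeries.C (MvPolynomial.X (Sum.inl i)) * PowerSeries.X) =
      ∏ j : Fin n, (1 + PowerSeries.C (MvPolynomial.X (Sum.inr j)) * PowerSeries.X) := by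
  refine ⟨(∏ j : Fin n, (1 + PowerSeries.C (MvPolynomial.X (Sum.inr j)) * PowerSeries.X)) *
    PowerSeries.invOfUnit (∏ i : Fin m, (1 - PowerSeries.C (MvPolynomial.X (Sum.inl i)) * PowerSeries.X)) 1, ?_⟩
  rw [mul_assoc, PowerSeries.invOfUnit_mul _ _ (by simp), mul_one]

theorem Rows_of_card {N : ℕ} {lam : YoungDiagram} (h : lam.card ≤ N) : Rows N lam := by
  intro i hi
  by_contra h1
  have : ((range (i+1)).image fun a => (a, 0)) ⊆ lam.cells := by
    intro c hc
    simp only [mem_image, mem_range] at hc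
    obtain ⟨a, ha, rfl⟩ := hc
    exact lam.up_left_mem (by omega) le_rfl (YoungDiagram.mem_iff_lt_rowLen.2 (Nat.pos_of_ne_zero h1))
  have h3 := Finset.card_le_card this
  rw [Finset.card_image_of_injective _ (fun a b h => by simpa using h), card_range] at h3
  unfold YoungDiagram.card at h
  omega

theorem exists_T (N B : ℕ) (P : Set YoungDiagram) (hP : ∀ σ, Rows N σ → σ ∈ P → σ.rowLen 0 ≤ B) :
    ∃ T : Finset YoungDiagram, ∀ σ, σ ∈ T ↔ Rows N σ ∧ σ ∈ P := by
  classical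
  obtain ⟨R, hR⟩ := exists_YD (fun i => if i < N then B else 0) (by
    intro a b hab
    dsimp only
    split_ifs <;> omega) N (by simp)
  refine ⟨(below R).filter fun σ => Rows N σ ∧ σ ∈ P, fun σ => ?_⟩
  rw [mem_filter, mem_below, le_iff_rowLen]
  refine ⟨fun h => h.2, fun h => ⟨fun i => ?_, h⟩⟩
  rw [hR]
  have h1 := hP σ h.1 h.2
  have h2 := σ.rowLen_anti 0 i (Nat.zero_le _)
  split_ifs with hi
  · omega
  · rw [h.1 i (by omega)]

theorem coeff_sss {m n : ℕ} (N : ℕ) (S P : Set YoungDiagram)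
    (hS : ∀ σ, σ ∈ S ↔ σ.rowLen m ≤ n ∧ σ ∈ P)
    (T : Finset YoungDiagram) (hT : ∀ σ, σ ∈ T ↔ Rows N σ ∧ σ ∈ P)
    (c : YoungDiagram → ℚ) (d : Fin m ⊕ Fin n →₀ ℕ) (hd : d.degree ≤ N) :
    MvPowerSeries.coeff d (superSchurSum m n S c) = ∑ σ ∈ T, c σ * (superSchurCoeff m n σ d : ℚ) := by
  have h0 : MvPowerSeries.coeff d (superSchurSum m n S c) = superSchurSum m n S c d := rfl
  rw [h0]
  unfold superSchurSum
  rw [tsum_subtype S (fun lam => c lam * (superSchurCoeff m n lam d : ℚ))]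
  rw [tsum_eq_sum (s := T)]
  · refine Finset.sum_congr rfl fun σ hσ => ?_
    by_cases h0 : superSchurCoeff m n σ d = 0
    · simp [Set.indicator, h0]
    · exact Set.indicator_of_mem ((hS σ).2 ⟨superCoeff_hook h0, ((hT σ).1 hσ).2⟩) _
  · intro σ hσ
    by_cases hs : σ ∈ S
    · rw [Set.indicator_of_mem hs]
      by_cases h0 : superSchurCoeff m n σ d = 0
      · simp [h0]
      · exfalso
        apply hσ
        refine (hT σ).2 ⟨Rows_of_card ?_, ((hS σ).1 hs).2⟩
        rw [superCoeff_card h0]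
        exact hd
    · exact Set.indicator_of_notMem hs _

theorem coeff_mul_congr {s : Type*} (A F G : MvPowerSeries s ℚ) (e : s →₀ ℕ)
    (h : ∀ d ≤ e, MvPowerSeries.coeff d F = MvPowerSeries.coeff d G) :
    MvPowerSeries.coeff e (A * F) = MvPowerSeries.coeff e (A * G) := by
  classical
  rw [MvPowerSeries.coeff_mul, MvPowerSeries.coeff_mul]
  refine Finset.sum_congr rfl fun q hq => ?_
  rw [h q.2 (by
    rw [Finset.HasAntidiagonal.mem_antidiagonal] at hq
    rw [← hq]
    exact le_add_self)]

theorem prod_pairs {R : Type*} [CommRing R] {M : ℕ} (x : Fin M → R) :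
    (∏ i, (1 - x i)) * (∏ q ∈ univ.filter (fun q : Fin M × Fin M => q.1 < q.2), (1 - x q.1 * x q.2))
      = DD x := by
  unfold DD
  rw [Finset.prod_filter, Fintype.prod_prod_type]

theorem final (m n p : ℕ) (hp : 0 < p) :
    (∏ ij : Fin m × Fin n, (1 + MvPowerSeries.X (Sum.inl ij.1) * MvPowerSeries.X (Sum.inr ij.2)))
      * superSchurSum m n ({lam : YoungDiagram | lam.rowLen m ≤ n} ∩ frobSet p)
          (fun lam => (-1 : ℚ)^((lam.cells.card - frobRank lam * (p-1))/2))
    = (∏ i : Fin m, (1 - MvPowerSeries.X (Sum.inl i)))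
      * (∏ ik ∈ Finset.univ.filter (fun q : Fin m × Fin m => q.1 < q.2),
          (1 - MvPowerSeries.X (Sum.inl ik.1) * MvPowerSeries.X (Sum.inl ik.2)))
      * (∏ j : Fin n, (1 - MvPowerSeries.X (Sum.inr j)))
      * (∏ jl ∈ Finset.univ.filter (fun q : Fin n × Fin n => q.1 < q.2),
          (1 - MvPowerSeries.X (Sum.inr jl.1) * MvPowerSeries.X (Sum.inr jl.2)))
      * superSchurSum m n {lam : YoungDiagram | lam.rowLen m ≤ n ∧ lam.rowLen 0 ≤ p}
          (fun _ => 1) := by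
  obtain ⟨h, hh⟩ := exists_h m n
  rw [prod_pairs (fun i : Fin m => (MvPowerSeries.X (Sum.inl i) : MvPowerSeries (Fin m ⊕ Fin n) ℚ)),
    mul_assoc (DD _), prod_pairs (fun j : Fin n =>
      (MvPowerSeries.X (Sum.inr j) : MvPowerSeries (Fin m ⊕ Fin n) ℚ)), Fintype.prod_prod_type]
  ext e
  set M := e.degree with hM
  have hdeg : ∀ d ≤ e, d.degree ≤ M + 1 := by
    intro d hd
    have := Finsupp.degree_mono hd
    omega
  obtain ⟨T₁, hT₁⟩ := exists_T (M+1) (p + (M+1)) (frobSet p) (fun σ h1 h2 => rowLen0_le h1 h2)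
  obtain ⟨T₂, hT₂⟩ := exists_T (M+1) p {σ | σ.rowLen 0 ≤ p} (fun σ _ h2 => h2)
  have e1 : ∀ d ≤ e, MvPowerSeries.coeff d (superSchurSum m n ({lam : YoungDiagram | lam.rowLen m ≤ n} ∩ frobSet p)
          (fun lam => (-1 : ℚ)^((lam.cells.card - frobRank lam * (p-1))/2))) =
      MvPowerSeries.coeff d ((GG (p+(M+1)) (M+1) h : MvPolynomial (Fin m ⊕ Fin n) ℚ) :
        MvPowerSeries (Fin m ⊕ Fin n) ℚ) := by
    intro d hd
    rw [MvPolynomial.coeff_coe, GG_eq p (M+1) hp h T₁ hT₁]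
    refine (coeff_sss (M+1) ({lam : YoungDiagram | lam.rowLen m ≤ n} ∩ frobSet p) (frobSet p) (fun σ => Iff.rfl) T₁ hT₁ _ d (hdeg d hd)).trans ?_
    rw [MvPolynomial.coeff_sum]
    refine Finset.sum_congr rfl fun σ hσ => ?_
    rw [← coeff_jt M h hh σ ((hT₁ σ).1 hσ).1]
    rw [show ((-1 : MvPolynomial (Fin m ⊕ Fin n) ℚ) ^ ee p σ) = MvPolynomial.C ((-1) ^ ee p σ) by simp,
      MvPolynomial.coeff_C_mul]
    rfl
  have e2 : ∀ d ≤ e, MvPowerSeries.coeff d (superSchurSum m n {lam : YoungDiagram | lam.rowLen m ≤ n ∧ lam.rowLen 0 ≤ p}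
          (fun _ => 1)) =
      MvPowerSeries.coeff d ((FF (p+(M+1)) (M+1) h : MvPolynomial (Fin m ⊕ Fin n) ℚ) :
        MvPowerSeries (Fin m ⊕ Fin n) ℚ) := by
    intro d hd
    rw [MvPolynomial.coeff_coe, FF_eq p M h T₂ hT₂]
    refine (coeff_sss (M+1) {lam : YoungDiagram | lam.rowLen m ≤ n ∧ lam.rowLen 0 ≤ p} {σ | σ.rowLen 0 ≤ p} (fun σ => Iff.rfl) T₂ hT₂ _ d (hdeg d hd)).trans ?_
    rw [MvPolynomial.coeff_sum]
    refine Finset.sum_congr rfl fun σ hσ => ?_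
    rw [← coeff_jt M h hh σ ((hT₂ σ).1 hσ).1, one_mul]
  rw [coeff_mul_congr _ _ _ e e1, coeff_mul_congr _ _ _ e e2]
  have key := main_poly (M+1) (p+(M+1)) h hh e (by omega)
  rw [← MvPolynomial.coeff_coe, ← MvPolynomial.coeff_coe] at key
  have hX : ∀ a, MvPolynomial.coeToMvPowerSeries.ringHom (MvPolynomial.X a : MvPolynomial (Fin m ⊕ Fin n) ℚ) = MvPowerSeries.X a := by
    intro a
    simp
  have c1 : ∀ q : MvPolynomial (Fin m ⊕ Fin n) ℚ, (q : MvPowerSeries (Fin m ⊕ Fin n) ℚ)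
    = MvPolynomial.coeToMvPowerSeries.ringHom q := fun q => rfl
  rw [c1, c1] at key
  simp only [map_mul, map_prod, map_add, map_one, map_DD, hX] at key
  exact key

end CF

/-- for every positive integer `p`, the character formula (for the
osp(2m+1|2n) representation `V(p)`, stripped of the lowest-weight prefactor):
`∏_{i,j}(1+x_i y_j) · Σ_{σ∈H_p} (-1)^{(|σ|-r(σ)(p-1))/2} s_σ(x|y)
 = ∏_i(1-x_i) ∏_{i<k}(1-x_i x_k) ∏_j(1-y_j) ∏_{j<l}(1-y_j y_l)
   · Σ_{λ∈H, λ_1≤p} s_λ(x|y)`. -/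
theorem character_formula (m n p : ℕ) (hm : 0 < m) (hn : 0 < n) (hp : 0 < p) :
    (∏ ij : Fin m × Fin n, (1 + X (Sum.inl ij.1) * X (Sum.inr ij.2)))
      * superSchurSum m n ({lam : YoungDiagram | lam.rowLen m ≤ n} ∩ frobSet p)
          (fun lam => (-1 : ℚ)^((lam.cells.card - frobRank lam * (p-1))/2))
    = (∏ i : Fin m, (1 - X (Sum.inl i)))
      * (∏ ik ∈ Finset.univ.filter (fun q : Fin m × Fin m => q.1 < q.2),
          (1 - X (Sum.inl ik.1) * X (Sum.inl ik.2)))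
      * (∏ j : Fin n, (1 - X (Sum.inr j)))
      * (∏ jl ∈ Finset.univ.filter (fun q : Fin n × Fin n => q.1 < q.2),
          (1 - X (Sum.inr jl.1) * X (Sum.inr jl.2)))
      * superSchurSum m n {lam : YoungDiagram | lam.rowLen m ≤ n ∧ lam.rowLen 0 ≤ p}
          (fun _ => 1) := by
  exact CF.final m n p hp

end
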